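/- arXiv:2507.07917 — 3 statements merged into one kernel-verified Lean document; each statement's English description precedes it below -/
import Mathlib

section
/- Let t > 0, and let μ ∈ ℝ^X and ν ∈ ℝ^Y have strictly positive entries and equal total mass. Then the entropic optimal transport problem inf{ t⟨c,γ⟩ + H(γ) : γ ∈ ℝ^{X×Y}, γ ⪰ 0, Aγ = (μ,ν) } admits a unique minimizer γ_t, and there exists ξ_t ∈ ℝ^X ⊕ ℝ^Y such that γ_t(x,y) = exp(t((A*ξ_t)_{x,y} − c(x,y))) for every (x,y) ∈ X×Y; moreover ξ_t is unique up to the addition of an element of ker A*, and ker A* has dimension 1. -/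
open scoped BigOperators
open Filter

noncomputable section

variable {X Y : Type*}

/-- The marginal map `A`. -/
def margA [Fintype X] [Fintype Y] (γ : X × Y → ℝ) : (X → ℝ) × (Y → ℝ) :=
  (fun x => ∑ y, γ (x, y), fun y => ∑ x, γ (x, y))

/-- The adjoint map `A*`. -/
def adjA (ξ : (X → ℝ) × (Y → ℝ)) : X × Y → ℝ := fun p => ξ.1 p.1 + ξ.2 p.2


/-- The adjoint map `A*` as a linear map. -/
def adjAlin (X Y : Type*) : ((X → ℝ) × (Y → ℝ)) →ₗ[ℝ] (X × Y → ℝ) where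
  toFun ξ := fun p => ξ.1 p.1 + ξ.2 p.2
  map_add' u v := by
    funext p
    show (u.1 + v.1) p.1 + (u.2 + v.2) p.2 = _
    simp [Pi.add_apply]
    ring
  map_smul' a v := by
    funext p
    show (a • v.1) p.1 + (a • v.2) p.2 = _
    simp [Pi.smul_apply, smul_eq_mul]
    ring

/-- Inner product on `ℝ^{X×Y}`. -/
def dotP [Fintype X] [Fintype Y] (c γ : X × Y → ℝ) : ℝ := ∑ p, c p * γ p

/-- Inner product on `ℝ^X ⊕ ℝ^Y`. -/
def dotE [Fintype X] [Fintype Y] (u v : (X → ℝ) × (Y → ℝ)) : ℝ :=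
  ∑ x, u.1 x * v.1 x + ∑ y, u.2 y * v.2 y

/-- The discrete entropy. -/
def ent [Fintype X] [Fintype Y] (γ : X × Y → ℝ) : EReal :=
  if ∀ p, 0 ≤ γ p then (((∑ p, γ p * (Real.log (γ p) - 1)) : ℝ) : EReal) else ⊤

/-- Fenchel conjugate of an `EReal`-valued function. -/
def conj [Fintype X] [Fintype Y] (F : (X → ℝ) × (Y → ℝ) → EReal)
    (ξ : (X → ℝ) × (Y → ℝ)) : EReal :=
  ⨆ v, ((dotE v ξ : ℝ) : EReal) - F v

/-- The regularized primal functional `C_t`. -/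
def Ct [Fintype X] [Fintype Y] (F : (X → ℝ) × (Y → ℝ) → EReal) (c : X × Y → ℝ)
    (t : ℝ) (γ : X × Y → ℝ) : EReal :=
  ((dotP c γ : ℝ) : EReal) + F (margA γ) + ((1 / t : ℝ) : EReal) * ent γ

/-- The regularized dual functional `K_t` (`EReal`-valued version). -/
def KtE [Fintype X] [Fintype Y] (F : (X → ℝ) × (Y → ℝ) → EReal) (c : X × Y → ℝ)
    (t : ℝ) (ξ : (X → ℝ) × (Y → ℝ)) : EReal :=
  conj F (-ξ) + (((1 / t) * ∑ p, Real.exp (t * (adjA ξ p - c p)) : ℝ) : EReal)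

/-- The regularized dual functional `K_t` (real-valued version, for a real-valued `F*`). -/
def KtR [Fintype X] [Fintype Y] (Fs : (X → ℝ) × (Y → ℝ) → ℝ) (c : X × Y → ℝ)
    (t : ℝ) (ξ : (X → ℝ) × (Y → ℝ)) : ℝ :=
  Fs (-ξ) + (1 / t) * ∑ p, Real.exp (t * (adjA ξ p - c p))

/-- (H1): `F` proper, convex, lower semicontinuous. -/
def H1 (F : (X → ℝ) × (Y → ℝ) → EReal) : Prop :=
  (∀ v, F v ≠ ⊥) ∧ (∃ v, F v ≠ ⊤) ∧
  (∀ v w : (X → ℝ) × (Y → ℝ), ∀ a b : ℝ, 0 ≤ a → 0 ≤ b → a + b = 1 →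
    F (a • v + b • w) ≤ (a : EReal) * F v + (b : EReal) * F w) ∧
  LowerSemicontinuous F

/-- (H2): there is a strictly positive point in the domain of `F`. -/
def H2 (F : (X → ℝ) × (Y → ℝ) → EReal) : Prop :=
  ∃ v : (X → ℝ) × (Y → ℝ), (∀ x, 0 < v.1 x) ∧ (∀ y, 0 < v.2 y) ∧ F v ≠ ⊤

/-- (H3): `F` is superlinear at infinity. -/
def H3 [Fintype X] [Fintype Y] (F : (X → ℝ) × (Y → ℝ) → EReal) : Prop :=
  ∀ M : ℝ, ∃ R : ℝ, ∀ v, R ≤ ‖v‖ → ((M * ‖v‖ : ℝ) : EReal) ≤ F v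

/-- (H4): a neighborhood of the origin intersected with the nonnegative orthant
lies in the domain of `F`. -/
def H4 (F : (X → ℝ) × (Y → ℝ) → EReal) : Prop :=
  ∃ W ∈ nhds (0 : (X → ℝ) × (Y → ℝ)),
    ∀ v ∈ W, (∀ x, 0 ≤ v.1 x) → (∀ y, 0 ≤ v.2 y) → F v ≠ ⊤

/-- (H5): strong convexity at every point (for the real-valued conjugate). -/
def H5 [Fintype X] [Fintype Y] (Fs : (X → ℝ) × (Y → ℝ) → ℝ) : Prop :=
  ∀ ξ₀ : (X → ℝ) × (Y → ℝ), ∃ r > (0 : ℝ), ∃ g : (X → ℝ) × (Y → ℝ), ∃ lam > (0 : ℝ),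
    (∀ ξ, Fs ξ₀ + dotE g (ξ - ξ₀) ≤ Fs ξ) ∧
    (∀ ξ, ‖ξ - ξ₀‖ ≤ r → Fs ξ₀ + dotE g (ξ - ξ₀) + lam / 2 * ‖ξ - ξ₀‖ ^ 2 ≤ Fs ξ)

/-- `Fs` is the (real-valued) Fenchel conjugate of `F`. -/
def IsConjOf [Fintype X] [Fintype Y] (F : (X → ℝ) × (Y → ℝ) → EReal)
    (Fs : (X → ℝ) × (Y → ℝ) → ℝ) : Prop :=
  ∀ ξ, (Fs ξ : EReal) = conj F ξ

end

section EntropicOT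

/-- The integrand of the discrete entropy lies above its tangent at every positive point. -/
lemma entropy_tangent_le {a b : ℝ} (ha : 0 ≤ a) (hb : 0 < b) :
    b * (Real.log b - 1) + Real.log b * (a - b) ≤ a * (Real.log a - 1) := by
  rcases ha.eq_or_lt with rfl | ha
  · simp only [zero_sub, zero_mul]; nlinarith
  · have h := Real.log_le_sub_one_of_pos (div_pos hb ha)
    rw [Real.log_div hb.ne' ha.ne'] at h
    have h2 := mul_le_mul_of_nonneg_left h ha.le
    have h3 : a * (b / a - 1) = b - a := by field_simp
    nlinarith

/-- The tangent inequality for the entropy integrand is strict away from the point of tangency. -/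
lemma entropy_tangent_lt {a b : ℝ} (ha : 0 ≤ a) (hb : 0 < b) (hab : a ≠ b) :
    b * (Real.log b - 1) + Real.log b * (a - b) < a * (Real.log a - 1) := by
  rcases ha.eq_or_lt with rfl | ha
  · simp only [zero_sub, zero_mul]; nlinarith
  · have hne : b / a ≠ 1 := fun h => hab ((div_eq_one_iff_eq ha.ne').1 h).symm
    have h := Real.log_lt_sub_one_of_pos (div_pos hb ha) hne
    rw [Real.log_div hb.ne' ha.ne'] at h
    have h2 := mul_lt_mul_of_pos_left h ha
    have h3 : a * (b / a - 1) = b - a := by field_simp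
    nlinarith

variable {X Y : Type*} [Fintype X] [Fintype Y]

/-- The real-valued entropic transport cost of a nonnegative plan. -/
noncomputable def entropicCost (c : X × Y → ℝ) (t : ℝ) (γ : X × Y → ℝ) : ℝ :=
  t * dotP c γ + ∑ p, γ p * (Real.log (γ p) - 1)

lemma coe_entropicCost (c : X × Y → ℝ) (t : ℝ) {γ : X × Y → ℝ} (hγ : ∀ p, 0 ≤ γ p) :
    ((t * dotP c γ : ℝ) : EReal) + ent γ = (entropicCost c t γ : EReal) := by
  rw [ent, if_pos hγ, entropicCost, EReal.coe_add]

lemma entropicCost_eq_sum (c : X × Y → ℝ) (t : ℝ) (γ : X × Y → ℝ) :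
    entropicCost c t γ = ∑ p, (t * c p * γ p + γ p * (Real.log (γ p) - 1)) := by
  simp [entropicCost, dotP, Finset.mul_sum, Finset.sum_add_distrib, mul_assoc]

lemma continuous_entropicCost (c : X × Y → ℝ) (t : ℝ) : Continuous (entropicCost c t) := by
  have h : entropicCost c t =
      fun γ => ∑ p, (t * c p * γ p + (γ p * Real.log (γ p) - γ p)) := by
    funext γ
    rw [entropicCost_eq_sum]
    exact Finset.sum_congr rfl fun p _ => by ring
  rw [h]
  refine continuous_finsetSum _ fun p _ => ?_
  have hp : Continuous fun γ : X × Y → ℝ => γ p := continuous_apply p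
  exact (continuous_const.mul hp).add ((Real.continuous_mul_log.comp hp).sub hp)

lemma entropicCost_tangent_le (c : X × Y → ℝ) (t : ℝ) {γ η : X × Y → ℝ}
    (hγ : ∀ p, 0 ≤ γ p) (hη : ∀ p, 0 < η p) :
    entropicCost c t η + ∑ p, (t * c p + Real.log (η p)) * (γ p - η p) ≤ entropicCost c t γ := by
  rw [entropicCost_eq_sum, entropicCost_eq_sum, ← Finset.sum_add_distrib]
  exact Finset.sum_le_sum fun p _ => by linarith [entropy_tangent_le (hγ p) (hη p)]

lemma entropicCost_tangent_lt (c : X × Y → ℝ) (t : ℝ) {γ η : X × Y → ℝ}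
    (hγ : ∀ p, 0 ≤ γ p) (hη : ∀ p, 0 < η p) (hne : γ ≠ η) :
    entropicCost c t η + ∑ p, (t * c p + Real.log (η p)) * (γ p - η p) < entropicCost c t γ := by
  obtain ⟨q, hq⟩ := Function.ne_iff.1 hne
  rw [entropicCost_eq_sum, entropicCost_eq_sum, ← Finset.sum_add_distrib]
  exact Finset.sum_lt_sum (fun p _ => by linarith [entropy_tangent_le (hγ p) (hη p)])
    ⟨q, Finset.mem_univ q, by linarith [entropy_tangent_lt (hγ q) (hη q) hq]⟩

/-- The set of nonnegative plans with marginals `μ` and `ν`. -/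
def transportPlans (μ : X → ℝ) (ν : Y → ℝ) : Set (X × Y → ℝ) :=
  {γ | (∀ p, 0 ≤ γ p) ∧ margA γ = (μ, ν)}

lemma margA_combination (a b : ℝ) (γ η : X × Y → ℝ) :
    margA (a • γ + b • η) = a • margA γ + b • margA η := by
  ext <;> simp [margA, Finset.sum_add_distrib, Finset.mul_sum]

lemma convex_transportPlans (μ : X → ℝ) (ν : Y → ℝ) : Convex ℝ (transportPlans μ ν) := by
  rintro γ ⟨hγ, hγm⟩ η ⟨hη, hηm⟩ a b ha hb hab
  refine ⟨fun p => ?_, ?_⟩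
  · simpa using add_nonneg (mul_nonneg ha (hγ p)) (mul_nonneg hb (hη p))
  · rw [margA_combination, hγm, hηm, ← add_smul, hab, one_smul]

lemma isCompact_transportPlans (μ : X → ℝ) (ν : Y → ℝ) : IsCompact (transportPlans μ ν) := by
  have hcont : Continuous (margA : (X × Y → ℝ) → _) := by
    unfold margA; fun_prop
  refine (isCompact_Icc (a := (0 : X × Y → ℝ)) (b := fun p => μ p.1)).of_isClosed_subset ?_ ?_
  · exact (isClosed_Ici (a := (0 : X × Y → ℝ))).inter (isClosed_singleton.preimage hcont)
  · rintro γ ⟨hγ, hm⟩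
    refine ⟨hγ, fun p => ?_⟩
    have h : ∑ y, γ (p.1, y) = μ p.1 := congrFun (congrArg Prod.fst hm) p.1
    change γ p ≤ μ p.1
    rw [← h]
    exact Finset.single_le_sum (f := fun y => γ (p.1, y)) (fun y _ => hγ _) (Finset.mem_univ p.2)

lemma exists_pos_mem_transportPlans [Nonempty X] {μ : X → ℝ} {ν : Y → ℝ}
    (hμ : ∀ x, 0 < μ x) (hν : ∀ y, 0 < ν y) (hmass : ∑ x, μ x = ∑ y, ν y) :
    ∃ γ ∈ transportPlans μ ν, ∀ p, 0 < γ p := by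
  have hm : 0 < ∑ x, μ x := Finset.sum_pos (fun x _ => hμ x) Finset.univ_nonempty
  have hpos : ∀ p : X × Y, 0 < μ p.1 * ν p.2 / ∑ x, μ x := fun p =>
    div_pos (mul_pos (hμ _) (hν _)) hm
  refine ⟨fun p => μ p.1 * ν p.2 / ∑ x, μ x, ⟨fun p => (hpos p).le, ?_⟩, hpos⟩
  ext z
  · simp only [margA]
    rw [← Finset.sum_div, ← Finset.mul_sum, ← hmass, mul_div_assoc, div_self hm.ne', mul_one]
  · simp only [margA]
    rw [← Finset.sum_div, ← Finset.sum_mul, mul_comm, mul_div_assoc, div_self hm.ne', mul_one]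

/-- Variational inequality satisfied by a minimizer along a segment. -/
lemma variational_inequality {c : X × Y → ℝ} {t s : ℝ} {γ h : X × Y → ℝ} {K : Set (X × Y → ℝ)}
    (hmin : IsMinOn (entropicCost c t) K γ) (hγ : ∀ p, 0 ≤ γ p) (hs : 0 < s)
    (hmem : γ + s • h ∈ K) (hpos : ∀ p, 0 < γ p + s * h p) :
    0 ≤ ∑ p, (t * c p + Real.log (γ p + s * h p)) * h p := by
  have h1 := entropicCost_tangent_le c t (η := γ + s • h) hγ hpos
  have h2 : entropicCost c t γ ≤ _ := hmin hmem
  have h3 : ∑ p, (t * c p + Real.log ((γ + s • h) p)) * (γ p - (γ + s • h) p) =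
      -(s * ∑ p, (t * c p + Real.log (γ p + s * h p)) * h p) := by
    rw [Finset.mul_sum, ← Finset.sum_neg_distrib]
    exact Finset.sum_congr rfl fun p _ => by simp; ring
  rw [h3] at h1
  exact nonneg_of_mul_nonneg_right (by linarith) hs

/-- A minimizer over the transport plans is strictly positive. -/
lemma pos_of_isMinOn [Nonempty X] {c : X × Y → ℝ} {t : ℝ} {μ : X → ℝ} {ν : Y → ℝ}
    (hμ : ∀ x, 0 < μ x) (hν : ∀ y, 0 < ν y) (hmass : ∑ x, μ x = ∑ y, ν y)
    {γ : X × Y → ℝ} (hγ : γ ∈ transportPlans μ ν)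
    (hmin : IsMinOn (entropicCost c t) (transportPlans μ ν) γ) (p : X × Y) : 0 < γ p := by
  classical
  obtain ⟨η, hη, hηpos⟩ := exists_pos_mem_transportPlans hμ hν hmass
  by_contra hp
  have hp0 : γ p = 0 := le_antisymm (not_lt.1 hp) (hγ.1 p)
  set C : ℝ := ∑ q, (t * c q + Real.log (η q)) * (η q - γ q)
  have key : ∀ s : ℝ, 0 < s → s ≤ 1 → 0 ≤ C + Real.log s * η p := by
    intro s hs hs1
    have hpos : ∀ q, 0 < γ q + s * (η - γ) q := fun q => by
      have h1 := mul_nonneg (sub_nonneg.2 hs1) (hγ.1 q)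
      have h2 := mul_pos hs (hηpos q)
      simp only [Pi.sub_apply]; linarith
    have hmem : γ + s • (η - γ) ∈ transportPlans μ ν :=
      (convex_transportPlans μ ν).add_smul_sub_mem hγ hη ⟨hs.le, hs1⟩
    refine (variational_inequality hmin hγ.1 hs hmem hpos).trans ?_
    have hle : ∀ q, Real.log (γ q + s * (η - γ) q) * (η q - γ q) ≤
        Real.log (η q) * (η q - γ q) := by
      intro q
      rcases le_total (γ q) (η q) with h | h
      · refine mul_le_mul_of_nonneg_right (Real.log_le_log (hpos q) ?_) (sub_nonneg.2 h)
        simp only [Pi.sub_apply]; nlinarith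
      · refine mul_le_mul_of_nonpos_right (Real.log_le_log (hηpos q) ?_) (sub_nonpos.2 h)
        simp only [Pi.sub_apply]; nlinarith
    rw [← Finset.add_sum_erase _ _ (Finset.mem_univ p)]
    simp only [C]
    rw [← Finset.add_sum_erase _ (fun q => (t * c q + Real.log (η q)) * (η q - γ q))
      (Finset.mem_univ p)]
    have hsum : ∑ q ∈ Finset.univ.erase p,
        (t * c q + Real.log (γ q + s * (η - γ) q)) * (η - γ) q ≤
        ∑ q ∈ Finset.univ.erase p, (t * c q + Real.log (η q)) * (η q - γ q) :=
      Finset.sum_le_sum fun q _ => by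
        have := hle q
        simp only [Pi.sub_apply] at this ⊢
        linarith
    have hpterm : (t * c p + Real.log (γ p + s * (η - γ) p)) * (η - γ) p =
        (t * c p + Real.log (η p)) * (η p - γ p) + Real.log s * η p := by
      simp only [Pi.sub_apply, hp0, zero_add, sub_zero]
      rw [Real.log_mul hs.ne' (hηpos p).ne']
      ring
    linarith
  have h := key (Real.exp (-((|C| + 1) / η p))) (Real.exp_pos _)
    (Real.exp_le_one_iff.2 (neg_nonpos.2 (div_nonneg (by positivity) (hηpos p).le)))
  rw [Real.log_exp, neg_mul, div_mul_cancel₀ _ (hηpos p).ne'] at h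
  linarith [le_abs_self C]

lemma entropicCost_minimizer_unique [Nonempty X] {c : X × Y → ℝ} {t : ℝ} {μ : X → ℝ} {ν : Y → ℝ}
    (hμ : ∀ x, 0 < μ x) (hν : ∀ y, 0 < ν y) (hmass : ∑ x, μ x = ∑ y, ν y)
    {γ η : X × Y → ℝ} (hγ : γ ∈ transportPlans μ ν) (hη : η ∈ transportPlans μ ν)
    (hγmin : IsMinOn (entropicCost c t) (transportPlans μ ν) γ)
    (hηmin : IsMinOn (entropicCost c t) (transportPlans μ ν) η) : γ = η := by
  by_contra hne
  have hγpos := pos_of_isMinOn hμ hν hmass hγ hγmin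
  set m : X × Y → ℝ := (1 / 2 : ℝ) • γ + (1 / 2 : ℝ) • η with hm
  have hmv : ∀ p, m p = 1 / 2 * γ p + 1 / 2 * η p := fun p => by simp [hm]
  have hmem : m ∈ transportPlans μ ν :=
    convex_transportPlans μ ν hγ hη (by norm_num) (by norm_num) (by norm_num)
  have hmpos : ∀ p, 0 < m p := fun p => by
    rw [hmv]; linarith [hγpos p, hη.1 p]
  have hγm : γ ≠ m := fun h => hne <| funext fun p => by
    linarith [hmv p, congrFun h p]
  have h1 := entropicCost_tangent_lt c t hγ.1 hmpos hγm
  have h2 := entropicCost_tangent_le c t hη.1 hmpos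
  have h3 : entropicCost c t γ ≤ entropicCost c t m := hγmin hmem
  have h4 : entropicCost c t η ≤ entropicCost c t m := hηmin hmem
  have h5 : ∑ p, (t * c p + Real.log (m p)) * (γ p - m p) +
      ∑ p, (t * c p + Real.log (m p)) * (η p - m p) = 0 := by
    rw [← Finset.sum_add_distrib]
    exact Finset.sum_eq_zero fun p _ => by
      rw [← mul_add, show γ p - m p + (η p - m p) = 0 by rw [hmv]; ring, mul_zero]
  linarith

/-- First-order condition: at a minimizer the gradient is nonnegative against directions with
vanishing marginals. -/
lemma gradient_nonneg [Nonempty X] {c : X × Y → ℝ} {t : ℝ} {μ : X → ℝ} {ν : Y → ℝ}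
    (hμ : ∀ x, 0 < μ x) (hν : ∀ y, 0 < ν y) (hmass : ∑ x, μ x = ∑ y, ν y)
    {γ : X × Y → ℝ} (hγ : γ ∈ transportPlans μ ν)
    (hmin : IsMinOn (entropicCost c t) (transportPlans μ ν) γ)
    {h : X × Y → ℝ} (hh : margA h = 0) :
    0 ≤ ∑ p, (t * c p + Real.log (γ p)) * h p := by
  have hpos := pos_of_isMinOn hμ hν hmass hγ hmin
  have hlim : ∀ p, Tendsto (fun s : ℝ => γ p + s * h p) (nhdsWithin 0 (Set.Ioi 0))
      (nhds (γ p)) := fun p => by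
    have : Continuous fun s : ℝ => γ p + s * h p := by fun_prop
    simpa using (this.tendsto 0).mono_left nhdsWithin_le_nhds
  have hev : ∀ᶠ s : ℝ in nhdsWithin 0 (Set.Ioi 0), ∀ p, 0 < γ p + s * h p :=
    eventually_all.2 fun p => (hlim p).eventually_const_lt (hpos p)
  refine ge_of_tendsto (x := nhdsWithin (0 : ℝ) (Set.Ioi 0))
    (f := fun s => ∑ p, (t * c p + Real.log (γ p + s * h p)) * h p) ?_ ?_
  · exact tendsto_finsetSum _ fun p _ =>
      (((hlim p).log (hpos p).ne').const_add _).mul_const _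
  · filter_upwards [hev, self_mem_nhdsWithin] with s hs hs0
    refine variational_inequality hmin hγ.1 hs0 ⟨fun p => (hs p).le, ?_⟩ hs
    simpa [hγ.2, hh] using margA_combination 1 s γ h

/-- A minimizer has the Gibbs form. -/
lemma exists_dual_potential [Nonempty X] [Nonempty Y] {c : X × Y → ℝ} {t : ℝ} (ht : 0 < t)
    {μ : X → ℝ} {ν : Y → ℝ}
    (hμ : ∀ x, 0 < μ x) (hν : ∀ y, 0 < ν y) (hmass : ∑ x, μ x = ∑ y, ν y)
    {γ : X × Y → ℝ} (hγ : γ ∈ transportPlans μ ν)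
    (hmin : IsMinOn (entropicCost c t) (transportPlans μ ν) γ) :
    ∃ ξ : (X → ℝ) × (Y → ℝ), ∀ p, γ p = Real.exp (t * (adjA ξ p - c p)) := by
  classical
  have hpos := pos_of_isMinOn hμ hν hmass hγ hmin
  obtain ⟨x₀⟩ := ‹Nonempty X›
  obtain ⟨y₀⟩ := ‹Nonempty Y›
  have : Nonempty X := ⟨x₀⟩
  set g : X × Y → ℝ := fun p => t * c p + Real.log (γ p)
  have hcycle : ∀ x x' y, 0 ≤ g (x, y) - g (x, y₀) - (g (x', y) - g (x', y₀)) := by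
    intro x x' y
    set a : X → ℝ := Pi.single x 1 - Pi.single x' 1 with ha
    set b : Y → ℝ := Pi.single y 1 - Pi.single y₀ 1 with hb
    have hasum : ∑ z, a z = 0 := by simp [ha]
    have hbsum : ∑ z, b z = 0 := by simp [hb]
    have hmarg : margA (fun p : X × Y => a p.1 * b p.2) = 0 := by
      ext z
      · simp [margA, ← Finset.mul_sum, hbsum]
      · simp [margA, ← Finset.sum_mul, hasum]
    refine (gradient_nonneg hμ hν hmass hγ hmin hmarg).trans_eq ?_
    have hinner : ∀ z, ∑ w, g (z, w) * (a z * b w) = a z * (g (z, y) - g (z, y₀)) := by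
      intro z
      simp [hb, Pi.single_apply, mul_sub, Finset.sum_sub_distrib]
      ring
    change ∑ p, g p * (a p.1 * b p.2) = _
    rw [Fintype.sum_prod_type]
    simp only [hinner]
    simp [ha, Pi.single_apply, sub_mul, Finset.sum_sub_distrib]
  refine ⟨(fun x => g (x, y₀) / t, fun y => (g (x₀, y) - g (x₀, y₀)) / t), fun p => ?_⟩
  obtain ⟨x, y⟩ := p
  have h1 := hcycle x x₀ y
  have h2 := hcycle x₀ x y
  have h3 : t * ((g (x, y₀) / t + (g (x₀, y) - g (x₀, y₀)) / t) - c (x, y)) =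
      g (x, y₀) + (g (x₀, y) - g (x₀, y₀)) - t * c (x, y) := by
    field_simp
  have h4 : g (x, y) = t * c (x, y) + Real.log (γ (x, y)) := rfl
  simp only [adjA]
  rw [h3, ← Real.exp_log (hpos (x, y))]
  rw [Real.exp_eq_exp]
  linarith


lemma mem_ker_adjAlin {X Y : Type*} {ξ : (X → ℝ) × (Y → ℝ)} :
    ξ ∈ LinearMap.ker (adjAlin X Y) ↔ ∀ p : X × Y, ξ.1 p.1 + ξ.2 p.2 = 0 := by
  rw [LinearMap.mem_ker]
  exact funext_iff

lemma finrank_ker_adjAlin (X Y : Type*) [Nonempty X] [Nonempty Y] :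
    Module.finrank ℝ (LinearMap.ker (adjAlin X Y)) = 1 := by
  obtain ⟨x₀⟩ := ‹Nonempty X›
  obtain ⟨y₀⟩ := ‹Nonempty Y›
  have hker : LinearMap.ker (adjAlin X Y) =
      Submodule.span ℝ {((fun _ => 1, fun _ => -1) : (X → ℝ) × (Y → ℝ))} := by
    ext ξ
    rw [mem_ker_adjAlin, Submodule.mem_span_singleton]
    constructor
    · intro h
      have h0 := h (x₀, y₀)
      refine ⟨ξ.1 x₀, Prod.ext (funext fun x => ?_) (funext fun y => ?_)⟩
      · have := h (x, y₀)
        simp at this h0 ⊢; linarith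
      · have := h (x₀, y)
        simp at this ⊢; linarith
    · rintro ⟨a, rfl⟩ p
      simp
  rw [hker]
  refine finrank_span_singleton fun h => ?_
  simpa using congrFun (congrArg Prod.fst h) x₀

end EntropicOT

/-- existence/uniqueness of the entropic OT minimizer, its
exponential representation via a dual vector, uniqueness of the dual vector up
to `ker A*`, and `dim ker A* = 1`. -/
theorem statement0 {X Y : Type*} [Fintype X] [Fintype Y] [Nonempty X] [Nonempty Y]
    (c : X × Y → ℝ) (hc : ∀ p, 0 ≤ c p)
    (μ : X → ℝ) (ν : Y → ℝ) (hμ : ∀ x, 0 < μ x) (hν : ∀ y, 0 < ν y)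
    (hmass : ∑ x, μ x = ∑ y, ν y) (t : ℝ) (ht : 0 < t) :
    (∃! γt : X × Y → ℝ,
      ((∀ p, 0 ≤ γt p) ∧ margA γt = (μ, ν)) ∧
      ∀ γ : X × Y → ℝ, (∀ p, 0 ≤ γ p) → margA γ = (μ, ν) →
        ((t * dotP c γt : ℝ) : EReal) + ent γt ≤ ((t * dotP c γ : ℝ) : EReal) + ent γ) ∧
    (∀ γt : X × Y → ℝ,
      (((∀ p, 0 ≤ γt p) ∧ margA γt = (μ, ν)) ∧
        ∀ γ : X × Y → ℝ, (∀ p, 0 ≤ γ p) → margA γ = (μ, ν) →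
          ((t * dotP c γt : ℝ) : EReal) + ent γt ≤ ((t * dotP c γ : ℝ) : EReal) + ent γ) →
      ∃ ξt : (X → ℝ) × (Y → ℝ),
        (∀ p, γt p = Real.exp (t * (adjA ξt p - c p))) ∧
        ∀ ξ' : (X → ℝ) × (Y → ℝ),
          ((∀ p, γt p = Real.exp (t * (adjA ξ' p - c p))) ↔
            ξ' - ξt ∈ LinearMap.ker (adjAlin X Y))) ∧
    Module.finrank ℝ (LinearMap.ker (adjAlin X Y)) = 1 := by
  have hiff : ∀ γt : X × Y → ℝ,
      (((∀ p, 0 ≤ γt p) ∧ margA γt = (μ, ν)) ∧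
        ∀ γ : X × Y → ℝ, (∀ p, 0 ≤ γ p) → margA γ = (μ, ν) →
          ((t * dotP c γt : ℝ) : EReal) + ent γt ≤ ((t * dotP c γ : ℝ) : EReal) + ent γ) ↔
      γt ∈ transportPlans μ ν ∧ IsMinOn (entropicCost c t) (transportPlans μ ν) γt := by
    refine fun γt => and_congr_right fun hγt => ?_
    rw [isMinOn_iff]
    constructor
    · intro h γ hγ
      have := h γ hγ.1 hγ.2
      rwa [coe_entropicCost c t hγt.1, coe_entropicCost c t hγ.1, EReal.coe_le_coe_iff] at this
    · intro h γ hγ hm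
      rw [coe_entropicCost c t hγt.1, coe_entropicCost c t hγ, EReal.coe_le_coe_iff]
      exact h γ ⟨hγ, hm⟩
  refine ⟨?_, fun γt hγt => ?_, finrank_ker_adjAlin X Y⟩
  · obtain ⟨η, hη, -⟩ := exists_pos_mem_transportPlans hμ hν hmass
    obtain ⟨γt, hmem, hmin⟩ := (isCompact_transportPlans μ ν).exists_isMinOn ⟨η, hη⟩
      (continuous_entropicCost c t).continuousOn
    refine ⟨γt, (hiff γt).2 ⟨hmem, hmin⟩, fun γ hγ => ?_⟩
    obtain ⟨hmem', hmin'⟩ := (hiff γ).1 hγ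
    exact entropicCost_minimizer_unique hμ hν hmass hmem' hmem hmin' hmin
  · obtain ⟨hmem, hmin⟩ := (hiff γt).1 hγt
    obtain ⟨ξ, hξ⟩ := exists_dual_potential ht hμ hν hmass hmem hmin
    refine ⟨ξ, hξ, fun ξ' => ?_⟩
    rw [mem_ker_adjAlin]
    refine forall_congr' fun p => ?_
    rw [hξ p, Real.exp_eq_exp, mul_right_inj' ht.ne', sub_left_inj, eq_comm, ← sub_eq_zero]
    simp only [adjA, Prod.fst_sub, Prod.snd_sub, Pi.sub_apply]
    rw [add_sub_add_comm]
end

section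
/- Assume (H1)–(H6). Then for every t > 0 the regularized dual functional K_t admits a unique minimizer ξ(t) over ℝ^X ⊕ ℝ^Y, and the trajectory t ↦ ξ(t) is continuously differentiable on (0, +∞). -/
open scoped BigOperators
open Filter

open Topology

section StronglyConvex

variable {E : Type*} [NormedAddCommGroup E] [NormedSpace ℝ E]

/-- `f` has at `x` a global affine minorant, which `f` exceeds by at least a positive multiple of
`‖y - x‖ ^ 2` for `y` near `x`. -/
def StronglyConvexAt (f : E → ℝ) (x : E) : Prop :=
  ∃ L : E →L[ℝ] ℝ, ∃ r > (0 : ℝ), ∃ lam > (0 : ℝ),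
    (∀ y, f x + L (y - x) ≤ f y) ∧
    (∀ y, ‖y - x‖ ≤ r → f x + L (y - x) + lam / 2 * ‖y - x‖ ^ 2 ≤ f y)

theorem StronglyConvexAt.comp_neg {f : E → ℝ} {x : E} (h : StronglyConvexAt f (-x)) :
    StronglyConvexAt (fun y => f (-y)) x := by
  obtain ⟨L, r, hr, lam, hlam, h1, h2⟩ := h
  have hsub (y : E) : -y - -x = -(y - x) := by abel
  refine ⟨-L, r, hr, lam, hlam, fun y => ?_, fun y hy => ?_⟩
  · have := h1 (-y)
    rw [hsub, map_neg] at this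
    simpa using this
  · have := h2 (-y) (by rwa [hsub, norm_neg])
    rw [hsub, map_neg, norm_neg] at this
    simpa using this

theorem StronglyConvexAt.add {f g : E → ℝ} {x : E} (h : StronglyConvexAt f x)
    {M : E →L[ℝ] ℝ} (hM : ∀ y, g x + M (y - x) ≤ g y) :
    StronglyConvexAt (fun y => f y + g y) x := by
  obtain ⟨L, r, hr, lam, hlam, h1, h2⟩ := h
  refine ⟨L + M, r, hr, lam, hlam, fun y => ?_, fun y hy => ?_⟩
  · have := h1 y
    have := hM y
    simp only [add_apply]
    linarith
  · have := h2 y hy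
    have := hM y
    simp only [add_apply]
    linarith

theorem convexOn_of_stronglyConvexAt {f : E → ℝ} (h : ∀ x, StronglyConvexAt f x) :
    ConvexOn ℝ Set.univ f := by
  refine ⟨convex_univ, fun x _ y _ a b ha hb hab => ?_⟩
  obtain ⟨L, -, -, -, -, h1, -⟩ := h (a • x + b • y)
  have hx := mul_le_mul_of_nonneg_left (h1 x) ha
  have hy := mul_le_mul_of_nonneg_left (h1 y) hb
  have hL : a * L (x - (a • x + b • y)) + b * L (y - (a • x + b • y)) = 0 := by
    obtain rfl : a = 1 - b := by linarith
    simp only [map_sub, map_add, map_smul, smul_eq_mul]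
    ring
  have hf : a * f (a • x + b • y) + b * f (a • x + b • y) = f (a • x + b • y) := by
    rw [← add_mul, hab, one_mul]
  simp only [smul_eq_mul]
  linarith

theorem strictConvexOn_of_stronglyConvexAt {f : E → ℝ} (h : ∀ x, StronglyConvexAt f x) :
    StrictConvexOn ℝ Set.univ f := by
  have hconv := convexOn_of_stronglyConvexAt h
  refine ⟨convex_univ, fun x _ y _ hxy a b ha hb hab => ?_⟩
  obtain ⟨L, r, hr, lam, hlam, h1, h2⟩ := h (a • x + b • y)
  set m := a • x + b • y with hm
  have hxm : 0 < ‖x - m‖ := by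
    have : x - m = b • (x - y) := by
      obtain rfl : a = 1 - b := by linarith
      rw [hm]
      module
    rw [this, norm_smul]
    exact mul_pos (norm_pos_iff.2 hb.ne') (norm_pos_iff.2 (sub_ne_zero.2 hxy))
  have hx : f m + L (x - m) < f x := by
    obtain ⟨s, hs0, hs1, hsr⟩ : ∃ s : ℝ, 0 < s ∧ s ≤ 1 ∧ s * ‖x - m‖ ≤ r := by
      refine ⟨min 1 (r / ‖x - m‖), by positivity, min_le_left _ _, ?_⟩
      exact (le_div_iff₀ hxm).1 (min_le_right _ _)
    have hsm : (1 - s) • m + s • x - m = s • (x - m) := by module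
    have hlow := h2 ((1 - s) • m + s • x) (by
      rwa [hsm, norm_smul, Real.norm_of_nonneg hs0.le])
    have hup := hconv.2 (Set.mem_univ m) (Set.mem_univ x) (sub_nonneg.2 hs1) hs0.le
      (sub_add_cancel 1 s)
    rw [hsm, map_smul, norm_smul] at hlow
    simp only [smul_eq_mul] at hlow hup
    have hpos : 0 < lam / 2 * (‖s‖ * ‖x - m‖) ^ 2 := by
      have : 0 < ‖s‖ := norm_pos_iff.2 hs0.ne'
      positivity
    have : s * (f m + L (x - m)) < s * f x := by linarith
    exact lt_of_mul_lt_mul_left this hs0.le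
  have hx' := mul_lt_mul_of_pos_left hx ha
  have hy' := mul_le_mul_of_nonneg_left (h1 y) hb.le
  have hL : a * L (x - m) + b * L (y - m) = 0 := by
    obtain rfl : a = 1 - b := by linarith
    simp only [hm, map_sub, map_add, map_smul, smul_eq_mul]
    ring
  have hf : a * f m + b * f m = f m := by rw [← add_mul, hab, one_mul]
  simp only [smul_eq_mul]
  linarith

theorem fderiv_eq_of_affine_le {f : E → ℝ} {x : E} (hf : DifferentiableAt ℝ f x)
    {L : E →L[ℝ] ℝ} (hL : ∀ y, f x + L (y - x) ≤ f y) : fderiv ℝ f x = L := by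
  have hmin : IsLocalMin (fun y => f y - L y) x := Filter.Eventually.of_forall fun y => by
    have := hL y
    rw [map_sub] at this
    linarith
  have h0 := hmin.hasFDerivAt_eq_zero (hf.hasFDerivAt.sub L.hasFDerivAt)
  exact sub_eq_zero.1 h0

theorem StronglyConvexAt.affine_le {f : E → ℝ} {x : E} (h : StronglyConvexAt f x)
    (hf : DifferentiableAt ℝ f x) (y : E) : f x + fderiv ℝ f x (y - x) ≤ f y := by
  obtain ⟨L, -, -, -, -, h1, -⟩ := h
  rw [fderiv_eq_of_affine_le hf h1]
  exact h1 y

theorem fderiv_fderiv_pos_of_stronglyConvexAt {f : E → ℝ} (h : ∀ x, StronglyConvexAt f x)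
    (hf : Differentiable ℝ f) {x : E} (hf' : DifferentiableAt ℝ (fderiv ℝ f) x)
    {v : E} (hv : v ≠ 0) : 0 < fderiv ℝ (fderiv ℝ f) x v v := by
  obtain ⟨L, r, hr, lam, hlam, h1, h2⟩ := h x
  have hL := fderiv_eq_of_affine_le (hf x) h1
  have hv' : 0 < ‖v‖ := norm_pos_iff.2 hv
  have hder : HasDerivAt (fun s : ℝ => fderiv ℝ f (x + s • v) v)
      (fderiv ℝ (fderiv ℝ f) x v v) 0 := by
    have hline : HasDerivAt (fun s : ℝ => x + s • v) v 0 := by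
      simpa using ((hasDerivAt_id (0 : ℝ)).smul_const v).const_add x
    have hcomp : HasDerivAt (fun s : ℝ => fderiv ℝ f (x + s • v))
        (fderiv ℝ (fderiv ℝ f) x v) 0 :=
      HasFDerivAt.comp_hasDerivAt (f := fun s : ℝ => x + s • v) 0
        (by simpa using hf'.hasFDerivAt) hline
    simpa using hcomp.clm_apply (hasDerivAt_const (0 : ℝ) v)
  have hslope := hder.tendsto_slope_zero_right
  suffices hle : lam / 2 * ‖v‖ ^ 2 ≤ fderiv ℝ (fderiv ℝ f) x v v from
    lt_of_lt_of_le (by positivity) hle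
  refine ge_of_tendsto hslope ?_
  filter_upwards [Ioo_mem_nhdsGT (div_pos hr hv')] with s hs
  have hs0 : 0 < s := hs.1
  have hsr : s * ‖v‖ ≤ r := (le_div_iff₀ hv').1 hs.2.le
  have hlow := h2 (x + s • v) (by
    rwa [add_sub_cancel_left, norm_smul, Real.norm_of_nonneg hs0.le])
  have hback := (h (x + s • v)).affine_le (hf _) x
  rw [add_sub_cancel_left, map_smul, norm_smul, Real.norm_of_nonneg hs0.le, smul_eq_mul] at hlow
  rw [show x - (x + s • v) = -(s • v) by abel, map_neg, map_smul, smul_eq_mul] at hback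
  simp only [zero_add, zero_smul, add_zero, smul_eq_mul, hL]
  rw [inv_mul_eq_div, le_div_iff₀ hs0]
  have : s * (lam / 2 * ‖v‖ ^ 2 * s) ≤ s * (fderiv ℝ f (x + s • v) v - L v) := by
    linarith
  exact le_of_mul_le_mul_left this hs0

/-- Implicit function theorem for minimizers: the unique minimizers of a `C²` family of strongly
convex functions form a `C¹` curve. -/
theorem exists_contDiffOn_minimizer [FiniteDimensional ℝ E] {K : ℝ → E → ℝ} {S : Set ℝ}
    (hS : IsOpen S) (hK : ∀ t ∈ S, ∀ x, ContDiffAt ℝ 2 (Function.uncurry K) (t, x))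
    (hconv : ∀ t ∈ S, ∀ x, StronglyConvexAt (K t) x)
    (hmin : ∀ t ∈ S, ∃ x, ∀ y, K t x ≤ K t y) :
    ∃ xi : ℝ → E,
      (∀ t ∈ S, (∀ y, K t (xi t) ≤ K t y) ∧
        ∀ x, (∀ y, K t x ≤ K t y) → x = xi t) ∧
      ContDiffOn ℝ 1 xi S := by
  have := FiniteDimensional.complete ℝ E
  have huniq : ∀ t ∈ S, ∀ x x', (∀ y, K t x ≤ K t y) → (∀ y, K t x' ≤ K t y) → x = x' :=
    fun t ht x x' hx hx' =>
      (strictConvexOn_of_stronglyConvexAt (hconv t ht)).eq_of_isMinOn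
        (fun y _ => hx y) (fun y _ => hx' y) (Set.mem_univ _) (Set.mem_univ _)
  choose! xi hxi using hmin
  refine ⟨xi, fun t ht => ⟨hxi t ht, fun x hx => huniq t ht x _ hx (hxi t ht)⟩, ?_⟩
  intro t ht
  refine ContDiffAt.contDiffWithinAt ?_
  have hKt : ∀ s ∈ S, ∀ x, ContDiffAt ℝ 2 (K s) x := fun s hs x =>
    (hK s hs x).comp x (contDiffAt_const.prodMk contDiffAt_id)
  have hdiff : ∀ s ∈ S, Differentiable ℝ (K s) := fun s hs x =>
    (hKt s hs x).differentiableAt two_ne_zero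
  set G : ℝ × E → E →L[ℝ] ℝ := fun u => fderiv ℝ (K u.1) u.2 with hG
  have hGc : ContDiffAt ℝ 1 G (t, xi t) := by
    refine ContDiffAt.fderiv (f := fun u : ℝ × E => K u.1) (g := Prod.snd) (n := 2) ?_
      contDiffAt_snd (by norm_num)
    exact ContDiffAt.comp (g := Function.uncurry K)
      (f := fun w : (ℝ × E) × E => (w.1.1, w.2)) ((t, xi t), xi t) (hK t ht (xi t))
      (by fun_prop)
  have hpart : fderiv ℝ G (t, xi t) ∘L .inr ℝ ℝ E = fderiv ℝ (fderiv ℝ (K t)) (xi t) :=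
    ((hGc.differentiableAt one_ne_zero).hasFDerivAt.comp (xi t)
      (hasFDerivAt_prodMk_right t (xi t))).fderiv.symm
  have hinj : Function.Injective (fderiv ℝ (fderiv ℝ (K t)) (xi t)) := by
    refine (injective_iff_map_eq_zero _).2 fun v hv => ?_
    by_contra hne
    have := fderiv_fderiv_pos_of_stronglyConvexAt (hconv t ht) (hdiff t ht)
      (((hKt t ht (xi t)).fderiv_right (m := 1) (by norm_num)).differentiableAt one_ne_zero) hne
    simp [hv] at this
  have hinv : (fderiv ℝ G (t, xi t) ∘L .inr ℝ ℝ E).IsInvertible := by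
    rw [hpart]
    have hrank : Module.finrank ℝ E = Module.finrank ℝ (E →L[ℝ] ℝ) := by
      rw [← (LinearMap.toContinuousLinearMap (𝕜 := ℝ) (E := E) (F' := ℝ)).finrank_eq]
      exact Subspace.dual_finrank_eq.symm
    exact ⟨(LinearEquiv.ofInjectiveOfFinrankEq _ hinj hrank).toContinuousLinearEquiv, by
      ext; rfl⟩
  have hG0 : G (t, xi t) = 0 :=
    IsLocalMin.fderiv_eq_zero (Filter.Eventually.of_forall (hxi t ht))
  refine (hGc.contDiffAt_implicitFunction one_ne_zero hinv).congr_of_eventuallyEq ?_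
  filter_upwards [hGc.eventually_apply_implicitFunction one_ne_zero hinv, hS.mem_nhds ht]
    with s hs hsS
  refine huniq s hsS _ _ (hxi s hsS) fun y => ?_
  have hle := (hconv s hsS (hGc.implicitFunction one_ne_zero hinv s)).affine_le (hdiff s hsS _) y
  rw [hG0] at hs
  rw [show fderiv ℝ (K s) (hGc.implicitFunction one_ne_zero hinv s) = 0 from hs] at hle
  simpa using hle

end StronglyConvex

section Dual

variable {X Y : Type*} [Fintype X] [Fintype Y]

theorem IsConjOf.dotE_sub_le {F : (X → ℝ) × (Y → ℝ) → EReal} {Fs : (X → ℝ) × (Y → ℝ) → ℝ}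
    (hFs : IsConjOf F Fs) {v : (X → ℝ) × (Y → ℝ)} (hbot : F v ≠ ⊥) (htop : F v ≠ ⊤)
    (ξ : (X → ℝ) × (Y → ℝ)) : dotE v ξ - (F v).toReal ≤ Fs ξ := by
  have h : ((dotE v ξ : ℝ) : EReal) - F v ≤ Fs ξ := by
    rw [hFs ξ]
    exact le_iSup (fun v => ((dotE v ξ : ℝ) : EReal) - F v) v
  rw [← EReal.coe_toReal htop hbot] at h
  exact_mod_cast h

theorem H4.exists_single_ne_top [DecidableEq X] [DecidableEq Y]
    {F : (X → ℝ) × (Y → ℝ) → EReal} (hF : H4 F) :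
    ∃ ε > (0 : ℝ), F 0 ≠ ⊤ ∧ (∀ x, F (Pi.single x ε, 0) ≠ ⊤) ∧ ∀ y, F (0, Pi.single y ε) ≠ ⊤ := by
  obtain ⟨W, hW, hdom⟩ := hF
  have hX (x : X) : ∀ᶠ ε : ℝ in 𝓝 0, ((Pi.single x ε, 0) : (X → ℝ) × (Y → ℝ)) ∈ W := by
    have hc : Continuous fun ε : ℝ => ((Pi.single x ε, 0) : (X → ℝ) × (Y → ℝ)) :=
      (continuous_single (A := fun _ : X => ℝ) x).prodMk continuous_const
    exact hc.continuousAt.eventually_mem (by simpa [Prod.mk_zero_zero] using hW)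
  have hY (y : Y) : ∀ᶠ ε : ℝ in 𝓝 0, ((0, Pi.single y ε) : (X → ℝ) × (Y → ℝ)) ∈ W := by
    have hc : Continuous fun ε : ℝ => ((0, Pi.single y ε) : (X → ℝ) × (Y → ℝ)) :=
      continuous_const.prodMk (continuous_single (A := fun _ : Y => ℝ) y)
    exact hc.continuousAt.eventually_mem (by simpa [Prod.mk_zero_zero] using hW)
  have hall := (Filter.eventually_all.2 hX).and (Filter.eventually_all.2 hY)
  obtain ⟨ε, ⟨hεX, hεY⟩, hε⟩ :=
    ((hall.filter_mono nhdsWithin_le_nhds).and (self_mem_nhdsWithin (s := Set.Ioi (0 : ℝ)))).exists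
  have hε' : 0 ≤ ε := (Set.mem_Ioi.1 hε).le
  refine ⟨ε, hε, hdom 0 (mem_of_mem_nhds hW) (fun _ => le_rfl) fun _ => le_rfl,
    fun x => hdom _ (hεX x) (fun x' => ?_) fun _ => le_rfl,
    fun y => hdom _ (hεY y) (fun _ => le_rfl) fun y' => ?_⟩
  · exact (Pi.single_nonneg (α := fun _ : X => ℝ)).2 hε' x'
  · exact (Pi.single_nonneg (α := fun _ : Y => ℝ)).2 hε' y'

theorem isBounded_KtR_le [Nonempty X] [Nonempty Y] (c : X × Y → ℝ)
    {F : (X → ℝ) × (Y → ℝ) → EReal} {Fs : (X → ℝ) × (Y → ℝ) → ℝ}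
    (hbot : ∀ v, F v ≠ ⊥) (hF4 : H4 F) (hFs : IsConjOf F Fs) {t : ℝ} (ht : 0 < t) (M : ℝ) :
    Bornology.IsBounded {ξ | KtR Fs c t ξ ≤ M} := by
  classical
  obtain ⟨ε, hε, h0, hX, hY⟩ := hF4.exists_single_ne_top
  obtain ⟨x₀⟩ := ‹Nonempty X›
  obtain ⟨y₀⟩ := ‹Nonempty Y›
  set a : X → ℝ := fun x => -((M + (F (Pi.single x ε, 0)).toReal) / ε)
  set b : Y → ℝ := fun y => -((M + (F (0, Pi.single y ε)).toReal) / ε)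
  refine (Metric.isBounded_Icc (a, b) (fun x => M + (F 0).toReal + c (x, y₀) - b y₀,
    fun y => M + (F 0).toReal + c (x₀, y) - a x₀)).subset fun ξ hξ => ?_
  have hξ : Fs (-ξ) + (1 / t) * ∑ p, Real.exp (t * (adjA ξ p - c p)) ≤ M := hξ
  have hFsM : Fs (-ξ) ≤ M := by
    have : 0 ≤ (1 / t) * ∑ p, Real.exp (t * (adjA ξ p - c p)) := by positivity
    linarith
  have ha (x : X) : a x ≤ ξ.1 x := by
    have := hFs.dotE_sub_le (hbot _) (hX x) (-ξ)
    simp only [dotE, Prod.fst_neg, Pi.neg_apply, Pi.single_apply, ite_mul, zero_mul,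
      Finset.sum_ite_eq', Finset.mem_univ, if_true, Pi.zero_apply, Finset.sum_const_zero,
      add_zero] at this
    rw [neg_le, le_div_iff₀ hε]
    linarith
  have hb (y : Y) : b y ≤ ξ.2 y := by
    have := hFs.dotE_sub_le (hbot _) (hY y) (-ξ)
    simp only [dotE, Prod.snd_neg, Pi.neg_apply, Pi.single_apply, ite_mul, zero_mul,
      Finset.sum_ite_eq', Finset.mem_univ, if_true, Pi.zero_apply, Finset.sum_const_zero,
      zero_add] at this
    rw [neg_le, le_div_iff₀ hε]
    linarith
  have hab (p : X × Y) : ξ.1 p.1 + ξ.2 p.2 - c p ≤ M + (F 0).toReal := by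
    have hlow := hFs.dotE_sub_le (hbot _) h0 (-ξ)
    simp only [dotE, Prod.fst_zero, Prod.snd_zero, Pi.zero_apply, zero_mul,
      Finset.sum_const_zero, add_zero, zero_sub] at hlow
    have hsingle : Real.exp (t * (adjA ξ p - c p)) ≤ ∑ q, Real.exp (t * (adjA ξ q - c q)) :=
      Finset.single_le_sum (f := fun q => Real.exp (t * (adjA ξ q - c q)))
        (fun q _ => (Real.exp_pos _).le) (Finset.mem_univ p)
    have hexp := Real.add_one_le_exp (t * (adjA ξ p - c p))
    have hmul : (1 / t) * (t * (adjA ξ p - c p)) ≤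
        (1 / t) * ∑ q, Real.exp (t * (adjA ξ q - c q)) :=
      mul_le_mul_of_nonneg_left (by linarith) (by positivity)
    rw [← mul_assoc, one_div_mul_cancel ht.ne', one_mul] at hmul
    have hadj : adjA ξ p = ξ.1 p.1 + ξ.2 p.2 := rfl
    linarith
  refine ⟨⟨ha, hb⟩, fun x => ?_, fun y => ?_⟩
  · have := hab (x, y₀)
    have := hb y₀
    dsimp only at *
    linarith
  · have := hab (x₀, y)
    have := ha x₀
    dsimp only at *
    linarith

theorem H5.stronglyConvexAt {Fs : (X → ℝ) × (Y → ℝ) → ℝ} (hF5 : H5 Fs)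
    (ξ : (X → ℝ) × (Y → ℝ)) : StronglyConvexAt Fs ξ := by
  obtain ⟨r, hr, g, lam, hlam, h1, h2⟩ := hF5 ξ
  let L : ((X → ℝ) × (Y → ℝ)) →ₗ[ℝ] ℝ :=
    { toFun := dotE g
      map_add' := fun u v => by
        simp only [dotE, Prod.fst_add, Prod.snd_add, Pi.add_apply, mul_add,
          Finset.sum_add_distrib]
        ring
      map_smul' := fun a v => by
        simp only [dotE, Prod.smul_fst, Prod.smul_snd, Pi.smul_apply, smul_eq_mul,
          RingHom.id_apply, mul_add, Finset.mul_sum, mul_left_comm] }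
  exact ⟨LinearMap.toContinuousLinearMap L, r, hr, lam, hlam, h1, h2⟩

theorem stronglyConvexAt_KtR (c : X × Y → ℝ) {Fs : (X → ℝ) × (Y → ℝ) → ℝ} (hF5 : H5 Fs)
    {t : ℝ} (ht : 0 < t) (ξ : (X → ℝ) × (Y → ℝ)) : StronglyConvexAt (KtR Fs c t) ξ := by
  refine (hF5.stronglyConvexAt (-ξ)).comp_neg.add
    (M := LinearMap.toContinuousLinearMap (∑ p, Real.exp (t * (adjA ξ p - c p)) •
      (LinearMap.proj p ∘ₗ adjAlin X Y))) fun ζ => ?_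
  have hM : (∑ p, Real.exp (t * (adjA ξ p - c p)) • (LinearMap.proj p ∘ₗ adjAlin X Y)) (ζ - ξ) =
      ∑ p, Real.exp (t * (adjA ξ p - c p)) * (adjA ζ p - adjA ξ p) := by
    rw [LinearMap.sum_apply]
    refine Finset.sum_congr rfl fun p _ => ?_
    simp only [LinearMap.smul_apply, LinearMap.comp_apply, map_sub, smul_eq_mul, ← mul_sub]
    rfl
  rw [LinearMap.coe_toContinuousLinearMap', hM, Finset.mul_sum, Finset.mul_sum,
    ← Finset.sum_add_distrib]
  refine Finset.sum_le_sum fun p _ => ?_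
  have hexp := Real.add_one_le_exp (t * (adjA ζ p - adjA ξ p))
  have hprod : Real.exp (t * (adjA ζ p - c p)) =
      Real.exp (t * (adjA ξ p - c p)) * Real.exp (t * (adjA ζ p - adjA ξ p)) := by
    rw [← Real.exp_add]
    ring_nf
  have hmul := mul_le_mul_of_nonneg_left hexp
    (mul_nonneg (one_div_pos.2 ht).le (Real.exp_pos (t * (adjA ξ p - c p))).le)
  rw [hprod]
  calc _ = 1 / t * Real.exp (t * (adjA ξ p - c p)) * (t * (adjA ζ p - adjA ξ p) + 1) := by
        field_simp
        ring
    _ ≤ _ := hmul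
    _ = _ := mul_assoc _ _ _

theorem contDiffAt_KtR (c : X × Y → ℝ) {Fs : (X → ℝ) × (Y → ℝ) → ℝ} {n : ℕ∞}
    (hF6 : ContDiff ℝ n Fs) {t : ℝ} (ht : t ≠ 0) (ξ : (X → ℝ) × (Y → ℝ)) :
    ContDiffAt ℝ n (Function.uncurry (KtR Fs c)) (t, ξ) := by
  have hadj (p : X × Y) : ContDiff ℝ n fun u : ℝ × ((X → ℝ) × (Y → ℝ)) => adjA u.2 p := by
    unfold adjA
    fun_prop
  have h1 : ContDiff ℝ n fun u : ℝ × ((X → ℝ) × (Y → ℝ)) => Fs (-u.2) :=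
    hF6.comp contDiff_snd.neg
  have h2 : ContDiff ℝ n fun u : ℝ × ((X → ℝ) × (Y → ℝ)) =>
      ∑ p, Real.exp (u.1 * (adjA u.2 p - c p)) :=
    ContDiff.sum fun p _ => (contDiff_fst.mul ((hadj p).sub contDiff_const)).exp
  exact h1.contDiffAt.add ((contDiffAt_const.div contDiffAt_fst ht).mul h2.contDiffAt)

end Dual

/-- under (H1)–(H6) the dual functional `K_t` has a unique
minimizer `ξ(t)` for every `t > 0`, and `t ↦ ξ(t)` is `C¹` on `(0,∞)`. -/
theorem statement9 {X Y : Type*} [Fintype X] [Fintype Y] [Nonempty X] [Nonempty Y]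
    (c : X × Y → ℝ) (hc : ∀ p, 0 ≤ c p)
    (F : (X → ℝ) × (Y → ℝ) → EReal) (Fs : (X → ℝ) × (Y → ℝ) → ℝ)
    (hF1 : H1 F) (hF2 : H2 F) (hF3 : H3 F) (hF4 : H4 F)
    (hFs : IsConjOf F Fs) (hF5 : H5 Fs) (hF6 : ContDiff ℝ 2 Fs) :
    ∃ xi : ℝ → (X → ℝ) × (Y → ℝ),
      (∀ t : ℝ, 0 < t →
        (∀ ζ, KtR Fs c t (xi t) ≤ KtR Fs c t ζ) ∧
        (∀ ζ, (∀ ζ', KtR Fs c t ζ ≤ KtR Fs c t ζ') → ζ = xi t)) ∧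
      ContDiffOn ℝ 1 xi (Set.Ioi 0) := by
  exact exists_contDiffOn_minimizer isOpen_Ioi
    (fun t ht ξ => contDiffAt_KtR c hF6 (ne_of_gt ht) ξ)
    (fun t ht ξ => stronglyConvexAt_KtR c hF5 ht ξ)
    fun t ht => Continuous.exists_forall_le_of_isBounded
      (continuous_iff_continuousAt.2 fun ξ =>
        ((contDiffAt_KtR c hF6 (ne_of_gt ht) ξ).continuousAt.comp
          (f := fun ζ => (t, ζ)) (by fun_prop)))
      0 (isBounded_KtR_le c hF1.1 hF4 hFs ht _)
end

section
/- Assume (H1)–(H6), let γ(t) be the unique minimizer of C_t for t > 0 and let γ* be the minimizer of the unbalanced optimal transport problem inf{⟨c,γ⟩ + F(Aγ) : γ ⪰ 0} with minimal discrete entropy H. Then the convergence rate of the primal trajectory is at least of order 1/√t: there exist C > 0 and T > 0 such that ‖γ(t) − γ*‖ ≤ C/√t for all t ≥ T. -/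
open scoped BigOperators
open Filter

section Adjoint

variable {X Y : Type*}

lemma adjA_sub (ξ η : (X → ℝ) × (Y → ℝ)) (p : X × Y) :
    adjA (ξ - η) p = adjA ξ p - adjA η p := by
  simp only [adjA, Prod.fst_sub, Prod.snd_sub, Pi.sub_apply]
  ring

lemma adjA_smul (a : ℝ) (ξ : (X → ℝ) × (Y → ℝ)) (p : X × Y) :
    adjA (a • ξ) p = a * adjA ξ p := by
  simp only [adjA, Prod.smul_fst, Prod.smul_snd, Pi.smul_apply, smul_eq_mul]
  ring

lemma continuous_adjA (p : X × Y) : Continuous fun ξ : (X → ℝ) × (Y → ℝ) => adjA ξ p := by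
  unfold adjA
  fun_prop

end Adjoint

section Pairings

variable {X Y : Type*} [Fintype X] [Fintype Y]

/-- The marginal map as a linear map. -/
def margLin (X Y : Type*) [Fintype X] [Fintype Y] :
    (X × Y → ℝ) →ₗ[ℝ] ((X → ℝ) × (Y → ℝ)) where
  toFun := margA
  map_add' u v := by
    ext <;> simp [margA, Finset.sum_add_distrib]
  map_smul' a v := by
    ext <;> simp [margA, Finset.mul_sum]

lemma margLin_apply (γ : X × Y → ℝ) : margLin X Y γ = margA γ := rfl

lemma margA_add (u v : X × Y → ℝ) : margA (u + v) = margA u + margA v :=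
  (margLin X Y).map_add u v

lemma margA_sub (u v : X × Y → ℝ) : margA (u - v) = margA u - margA v :=
  (margLin X Y).map_sub u v

lemma margA_smul (a : ℝ) (v : X × Y → ℝ) : margA (a • v) = a • margA v :=
  (margLin X Y).map_smul a v

lemma exists_norm_margA_le : ∃ K > 0, ∀ γ : X × Y → ℝ, ‖margA γ‖ ≤ K * ‖γ‖ := by
  refine ⟨‖(margLin X Y).toContinuousLinearMap‖ + 1, by positivity, fun γ => ?_⟩
  refine ((margLin X Y).toContinuousLinearMap.le_opNorm γ).trans ?_
  gcongr
  linarith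

lemma dotE_margA (γ : X × Y → ℝ) (ξ : (X → ℝ) × (Y → ℝ)) :
    dotE (margA γ) ξ = ∑ p, γ p * adjA ξ p := by
  simp only [dotE, margA, adjA, mul_add, Finset.sum_add_distrib, Fintype.sum_prod_type,
    Finset.sum_mul]
  congr 1
  exact Finset.sum_comm

lemma abs_fst_le_norm (ξ : (X → ℝ) × (Y → ℝ)) (x : X) : |ξ.1 x| ≤ ‖ξ‖ :=
  (norm_le_pi_norm ξ.1 x).trans (norm_fst_le ξ)

lemma abs_snd_le_norm (ξ : (X → ℝ) × (Y → ℝ)) (y : Y) : |ξ.2 y| ≤ ‖ξ‖ :=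
  (norm_le_pi_norm ξ.2 y).trans (norm_snd_le ξ)

lemma abs_adjA_le (ξ : (X → ℝ) × (Y → ℝ)) (p : X × Y) : |adjA ξ p| ≤ 2 * ‖ξ‖ := by
  have h1 := abs_fst_le_norm ξ p.1
  have h2 := abs_snd_le_norm ξ p.2
  have h3 := abs_add_le (ξ.1 p.1) (ξ.2 p.2)
  simp only [adjA]
  linarith

/-- `dotE v` as a continuous linear form. -/
noncomputable def dotCLM (v : (X → ℝ) × (Y → ℝ)) : ((X → ℝ) × (Y → ℝ)) →L[ℝ] ℝ :=
  LinearMap.toContinuousLinearMap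
    { toFun := dotE v
      map_add' := fun a b => by
        simp only [dotE, Prod.fst_add, Prod.snd_add, Pi.add_apply, mul_add,
          Finset.sum_add_distrib]
        ring
      map_smul' := fun a b => by
        simp only [dotE, Prod.smul_fst, Prod.smul_snd, Pi.smul_apply, smul_eq_mul,
          RingHom.id_apply, mul_add, Finset.mul_sum]
        congr 1 <;> exact Finset.sum_congr rfl fun _ _ => by ring }

lemma dotCLM_apply (v ξ : (X → ℝ) × (Y → ℝ)) : dotCLM v ξ = dotE v ξ := rfl

lemma dotE_sub_right (v ξ η : (X → ℝ) × (Y → ℝ)) :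
    dotE v (ξ - η) = dotE v ξ - dotE v η := (dotCLM v).map_sub ξ η

lemma dotE_neg_right (v ξ : (X → ℝ) × (Y → ℝ)) : dotE v (-ξ) = -dotE v ξ :=
  (dotCLM v).map_neg ξ

lemma dotE_smul_right (a : ℝ) (v ξ : (X → ℝ) × (Y → ℝ)) : dotE v (a • ξ) = a * dotE v ξ :=
  (dotCLM v).map_smul a ξ

lemma dotE_comm (v ξ : (X → ℝ) × (Y → ℝ)) : dotE v ξ = dotE ξ v := by
  simp only [dotE, mul_comm]

lemma dotE_single_fst [DecidableEq X] (v : (X → ℝ) × (Y → ℝ)) (x : X) :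
    dotE v (Pi.single x 1, 0) = v.1 x := by
  simp [dotE, Pi.single_apply]

lemma dotE_single_snd [DecidableEq Y] (v : (X → ℝ) × (Y → ℝ)) (y : Y) :
    dotE v (0, Pi.single y 1) = v.2 y := by
  simp [dotE, Pi.single_apply]

lemma dotE_left_injective {v w : (X → ℝ) × (Y → ℝ)} (h : ∀ d, dotE v d = dotE w d) :
    v = w := by
  classical
  ext x
  · simpa only [dotE_single_fst] using h (Pi.single x 1, 0)
  · simpa only [dotE_single_snd] using h (0, Pi.single x 1)

lemma norm_sub_le_norm_dotCLM_sub (v w : (X → ℝ) × (Y → ℝ)) :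
    ‖v - w‖ ≤ ‖dotCLM v - dotCLM w‖ := by
  classical
  have key (d : (X → ℝ) × (Y → ℝ)) (hd : ‖d‖ ≤ 1) :
      |dotE v d - dotE w d| ≤ ‖dotCLM v - dotCLM w‖ := by
    have := (dotCLM v - dotCLM w).le_opNorm d
    rw [sub_apply, dotCLM_apply, dotCLM_apply, Real.norm_eq_abs] at this
    nlinarith [norm_nonneg (dotCLM v - dotCLM w)]
  rw [Prod.norm_def, max_le_iff, pi_norm_le_iff_of_nonneg (norm_nonneg _),
    pi_norm_le_iff_of_nonneg (norm_nonneg _)]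
  constructor
  · intro x
    have := key (Pi.single x 1, 0) (by simp [Prod.norm_def, Pi.norm_single])
    simpa only [dotE_single_fst, Prod.fst_sub, Pi.sub_apply, Real.norm_eq_abs] using this
  · intro y
    have := key (0, Pi.single y 1) (by simp [Prod.norm_def, Pi.norm_single])
    simpa only [dotE_single_snd, Prod.snd_sub, Pi.sub_apply, Real.norm_eq_abs] using this

end Pairings

section Subgradients

variable {X Y : Type*} [Fintype X] [Fintype Y]

lemma fderiv_eq_dotCLM_of_subgradient {f : (X → ℝ) × (Y → ℝ) → ℝ} (hf : Differentiable ℝ f)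
    {ξ₀ v : (X → ℝ) × (Y → ℝ)} (h : ∀ ξ, f ξ₀ + dotE v (ξ - ξ₀) ≤ f ξ) :
    fderiv ℝ f ξ₀ = dotCLM v := by
  have hmin : IsLocalMin (fun ξ => f ξ - dotCLM v ξ) ξ₀ := by
    refine Filter.Eventually.of_forall fun ξ => ?_
    have := h ξ
    rw [dotE_sub_right] at this
    simp only [dotCLM_apply]
    linarith
  have h0 := hmin.fderiv_eq_zero
  rw [fderiv_fun_sub (hf ξ₀) (dotCLM v).differentiableAt, ContinuousLinearMap.fderiv,
    sub_eq_zero] at h0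
  exact h0

variable {F : (X → ℝ) × (Y → ℝ) → EReal} {Fs : (X → ℝ) × (Y → ℝ) → ℝ}

lemma fenchel_young (hF1 : H1 F) (hFs : IsConjOf F Fs) (v ξ : (X → ℝ) × (Y → ℝ)) :
    ((dotE v ξ - Fs ξ : ℝ) : EReal) ≤ F v := by
  have h : ((dotE v ξ : ℝ) : EReal) - F v ≤ Fs ξ := by
    rw [hFs ξ]
    exact le_iSup (fun v => ((dotE v ξ : ℝ) : EReal) - F v) v
  rw [EReal.sub_le_iff_le_add (Or.inl (hF1.1 v)) (Or.inr (EReal.coe_ne_bot _))] at h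
  rcases eq_or_ne (F v) ⊤ with hv | hv
  · simp [hv]
  · lift F v to ℝ using ⟨hv, hF1.1 v⟩ with r
    norm_cast at h ⊢
    linarith

lemma fenchel_young_real (hF1 : H1 F) (hFs : IsConjOf F Fs) {v : (X → ℝ) × (Y → ℝ)} {r : ℝ}
    (hr : F v = r) (ξ : (X → ℝ) × (Y → ℝ)) : dotE v ξ - Fs ξ ≤ r := by
  have := fenchel_young hF1 hFs v ξ
  rw [hr] at this
  exact_mod_cast this

lemma subgradient_of_fenchel_eq (hF1 : H1 F) (hFs : IsConjOf F Fs)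
    {v ξ₀ : (X → ℝ) × (Y → ℝ)} (h : F v = ((dotE v ξ₀ - Fs ξ₀ : ℝ) : EReal))
    (ξ : (X → ℝ) × (Y → ℝ)) : Fs ξ₀ + dotE v (ξ - ξ₀) ≤ Fs ξ := by
  have := fenchel_young_real hF1 hFs h ξ
  rw [dotE_sub_right]
  linarith

lemma exists_fenchel_eq (hF1 : H1 F) (hF3 : H3 F) (hFs : IsConjOf F Fs)
    (ξ : (X → ℝ) × (Y → ℝ)) : ∃ v, F v = ((dotE v ξ - Fs ξ : ℝ) : EReal) := by
  obtain ⟨v₀, hv₀⟩ := hF1.2.1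
  obtain ⟨a, ha⟩ : ∃ a : ℝ, F v₀ = a := by
    lift F v₀ to ℝ using ⟨hv₀, hF1.1 v₀⟩ with r
    exact ⟨r, rfl⟩
  set G : (X → ℝ) × (Y → ℝ) → EReal := fun v => F v + ((-dotE v ξ : ℝ) : EReal) with hG
  have hcont : Continuous fun v : (X → ℝ) × (Y → ℝ) => ((-dotE v ξ : ℝ) : EReal) := by
    refine continuous_coe_real_ereal.comp ?_
    simp only [dotE_comm _ ξ]
    exact (dotCLM ξ).continuous.neg
  have hlsc : LowerSemicontinuous G := by
    refine hF1.2.2.2.add' hcont.lowerSemicontinuous fun v => ?_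
    exact EReal.continuousAt_add (Or.inr (EReal.coe_ne_bot _)) (Or.inr (EReal.coe_ne_top _))
  obtain ⟨R, hR⟩ := hF3 (‖dotCLM ξ‖ + 1)
  have hR' (v : (X → ℝ) × (Y → ℝ)) (hv : R ≤ ‖v‖) : ((‖v‖ : ℝ) : EReal) ≤ G v := by
    have h1 : dotE v ξ ≤ ‖dotCLM ξ‖ * ‖v‖ := by
      rw [dotE_comm]
      exact (le_abs_self _).trans ((dotCLM ξ).le_opNorm v)
    calc ((‖v‖ : ℝ) : EReal)
        ≤ (((‖dotCLM ξ‖ + 1) * ‖v‖ + -dotE v ξ : ℝ) : EReal) := by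
          norm_cast
          linarith
      _ = (((‖dotCLM ξ‖ + 1) * ‖v‖ : ℝ) : EReal) + ((-dotE v ξ : ℝ) : EReal) := by norm_cast
      _ ≤ G v := add_le_add_left (hR v hv) _
  set B : ℝ := max (max R ‖v₀‖) (a - dotE v₀ ξ) with hB
  have hv₀B : v₀ ∈ Metric.closedBall (0 : (X → ℝ) × (Y → ℝ)) B := by
    rw [mem_closedBall_zero_iff]
    exact (le_max_right _ _).trans (le_max_left _ _)
  obtain ⟨v, -, hvmin⟩ := (hlsc.lowerSemicontinuousOn _).exists_isMinOn ⟨v₀, hv₀B⟩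
    (isCompact_closedBall (0 : (X → ℝ) × (Y → ℝ)) B)
  have hG₀ : G v₀ = ((a - dotE v₀ ξ : ℝ) : EReal) := by
    simp only [hG, ha]
    norm_cast
  have hmin (w : (X → ℝ) × (Y → ℝ)) : G v ≤ G w := by
    by_cases hw : w ∈ Metric.closedBall (0 : (X → ℝ) × (Y → ℝ)) B
    · exact hvmin hw
    · rw [mem_closedBall_zero_iff, not_le] at hw
      refine (hvmin hv₀B).trans (le_trans ?_ (hR' w ?_))
      · rw [hG₀]
        exact_mod_cast (le_max_right _ _).trans hw.le
      · exact ((le_max_left _ _).trans (le_max_left _ _)).trans hw.le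
  have hFv : F v ≠ ⊤ := by
    intro htop
    have := hmin v₀
    rw [hG₀] at this
    simp only [hG, htop, EReal.top_add_coe, top_le_iff] at this
    exact EReal.coe_ne_top _ this
  obtain ⟨b, hb⟩ : ∃ b : ℝ, F v = b := by
    lift F v to ℝ using ⟨hFv, hF1.1 v⟩ with r
    exact ⟨r, rfl⟩
  refine ⟨v, le_antisymm ?_ (fenchel_young hF1 hFs v ξ)⟩
  have hconj : (Fs ξ : EReal) ≤ ((dotE v ξ - b : ℝ) : EReal) := by
    rw [hFs ξ]
    refine iSup_le fun w => ?_
    have := hmin w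
    rcases eq_or_ne (F w) ⊤ with hw | hw
    · simp [hw]
    · simp only [hG, hb] at this
      lift F w to ℝ using ⟨hw, hF1.1 w⟩ with r
      norm_cast at this ⊢
      linarith
  rw [hb]
  norm_cast at hconj ⊢
  linarith

lemma convexOn_of_isConjOf (hF1 : H1 F) (hF3 : H3 F) (hFs : IsConjOf F Fs) :
    ConvexOn ℝ Set.univ Fs := by
  refine ⟨convex_univ, fun ξ _ η _ a b ha hb hab => ?_⟩
  obtain ⟨v, hv⟩ := exists_fenchel_eq hF1 hF3 hFs (a • ξ + b • η)
  have h1 := fenchel_young_real hF1 hFs hv ξ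
  have h2 := fenchel_young_real hF1 hFs hv η
  have h3 : dotE v (a • ξ + b • η) = a * dotE v ξ + b * dotE v η := by
    rw [← dotE_smul_right, ← dotE_smul_right]
    exact (dotCLM v).map_add _ _
  have h4 := mul_le_mul_of_nonneg_left h1 ha
  have h5 := mul_le_mul_of_nonneg_left h2 hb
  simp only [smul_eq_mul]
  rw [h3] at h4 h5
  obtain rfl : b = 1 - a := by linarith
  nlinarith

end Subgradients

section ErrorBounds

open Topology

lemma LinearMap.exists_preimage_norm_le_of_range {E G : Type*}
    [NormedAddCommGroup E] [NormedSpace ℝ E] [FiniteDimensional ℝ E]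
    [NormedAddCommGroup G] [NormedSpace ℝ G] [FiniteDimensional ℝ G] (f : E →ₗ[ℝ] G) :
    ∃ C > 0, ∀ x, ∃ x', f x' = f x ∧ ‖x'‖ ≤ C * ‖f x‖ := by
  obtain ⟨g, hg⟩ := f.rangeRestrict.exists_rightInverse_of_surjective f.range_rangeRestrict
  refine ⟨‖g.toContinuousLinearMap‖ + 1, by positivity, fun x => ⟨g (f.rangeRestrict x), ?_, ?_⟩⟩
  · have := congrArg Subtype.val (LinearMap.congr_fun hg (f.rangeRestrict x))
    simpa using this
  · refine (g.toContinuousLinearMap.le_opNorm (f.rangeRestrict x)).trans ?_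
    gcongr
    · linarith
    · exact le_rfl

/-- A Hoffman-type bound: if a closed cone meets the preimage of a subspace only at the origin,
the distance of the image to this subspace controls the norm on the cone. -/
lemma LinearMap.exists_norm_le_of_cone {E G : Type*}
    [NormedAddCommGroup E] [NormedSpace ℝ E] [FiniteDimensional ℝ E]
    [NormedAddCommGroup G] [NormedSpace ℝ G] [FiniteDimensional ℝ G] (f : E →ₗ[ℝ] G)
    (W : Submodule ℝ G) {K : Set E} (hK : IsClosed K)
    (hsmul : ∀ a : ℝ, 0 < a → ∀ x ∈ K, a • x ∈ K) (h : ∀ x ∈ K, f x ∈ W → x = 0) :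
    ∃ C > 0, ∀ x ∈ K, ∀ w ∈ W, ‖x‖ ≤ C * ‖f x + w‖ := by
  have hW : IsClosed (W : Set G) := W.closed_of_finiteDimensional
  have hcomp : IsCompact (K ∩ Metric.sphere 0 1) := (isCompact_sphere 0 1).inter_left hK
  have hcont : Continuous fun x => Metric.infDist (f x) (W : Set G) :=
    (Metric.continuous_infDist_pt _).comp f.continuous_of_finiteDimensional
  obtain ⟨k, hk, hbound⟩ : ∃ k > 0, ∀ x ∈ K ∩ Metric.sphere (0 : E) 1,
      k ≤ Metric.infDist (f x) (W : Set G) := by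
    rcases (K ∩ Metric.sphere (0 : E) 1).eq_empty_or_nonempty with hemp | hne
    · exact ⟨1, one_pos, fun x hx => by simp [hemp] at hx⟩
    · obtain ⟨x₀, hx₀, hmin⟩ := hcomp.exists_isMinOn hne hcont.continuousOn
      refine ⟨_, lt_of_le_of_ne Metric.infDist_nonneg fun h0 => ?_, fun x hx => hmin hx⟩
      have := h x₀ hx₀.1 ((hW.mem_iff_infDist_zero ⟨0, W.zero_mem⟩).2 h0.symm)
      simpa [this] using hx₀.2
  refine ⟨k⁻¹, inv_pos.2 hk, fun x hx w hw => ?_⟩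
  rcases eq_or_ne x 0 with rfl | hx0
  · simp only [norm_zero]
    positivity
  have hpos : 0 < ‖x‖ := norm_pos_iff.2 hx0
  have h1 := hbound (‖x‖⁻¹ • x) ⟨hsmul _ (inv_pos.2 hpos) _ hx, by
    simp [norm_smul, hpos.ne']⟩
  have h2 : Metric.infDist (f (‖x‖⁻¹ • x)) (W : Set G) ≤ ‖x‖⁻¹ * ‖f x + w‖ := by
    refine (Metric.infDist_le_dist_of_mem (y := -(‖x‖⁻¹ • w))
      (W.neg_mem (W.smul_mem _ hw))).trans (le_of_eq ?_)
    rw [dist_eq_norm, map_smul, sub_neg_eq_add, ← smul_add, norm_smul, norm_inv, norm_norm]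
  have h3 := h1.trans h2
  rw [inv_mul_eq_div, le_div_iff₀ hpos] at h3
  rw [inv_mul_eq_div, le_div_iff₀ hk]
  linarith

/-- First-order conditions at a minimizer of the entropy along a nonnegative segment. -/
lemma entropy_first_order {ι : Type*} [Fintype ι] {a δ : ι → ℝ} (ha : ∀ p, 0 ≤ a p)
    (hδ : ∀ p, a p = 0 → 0 ≤ δ p)
    (hmin : ∀ ε : ℝ, 0 < ε → (∀ p, 0 ≤ a p + ε * δ p) →
      ∑ p, a p * (Real.log (a p) - 1) ≤
        ∑ p, (a p + ε * δ p) * (Real.log (a p + ε * δ p) - 1)) :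
    (∀ p, a p = 0 → δ p = 0) ∧ 0 ≤ ∑ p, δ p * Real.log (a p) := by
  classical
  have hlim (p : ι) : Tendsto (fun ε : ℝ => a p + ε * δ p) (𝓝[>] 0) (𝓝 (a p)) := by
    have : Continuous fun ε : ℝ => a p + ε * δ p := by fun_prop
    have h := this.tendsto 0
    simp only [zero_mul, add_zero] at h
    exact h.mono_left nhdsWithin_le_nhds
  have hpos (p : ι) (hp : a p ≠ 0) : ∀ᶠ ε : ℝ in 𝓝[>] 0, 0 < a p + ε * δ p :=
    (hlim p).eventually (lt_mem_nhds (lt_of_le_of_ne (ha p) hp.symm))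
  have hev : ∀ᶠ ε : ℝ in 𝓝[>] 0, 0 ≤ ∑ p, δ p * Real.log (a p + ε * δ p) := by
    have hall : ∀ᶠ ε : ℝ in 𝓝[>] 0, ∀ p, a p ≠ 0 → 0 < a p + ε * δ p := by
      rw [eventually_all]
      intro p
      by_cases hp : a p = 0
      · exact Eventually.of_forall fun _ h => absurd hp h
      · exact (hpos p hp).mono fun _ h _ => h
    filter_upwards [hall, self_mem_nhdsWithin] with ε hε hε0
    have hε0 : 0 < ε := hε0
    have hnn (p : ι) : 0 ≤ a p + ε * δ p := by
      by_cases hp : a p = 0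
      · rw [hp, zero_add]
        exact mul_nonneg hε0.le (hδ p hp)
      · exact (hε p hp).le
    have hterm (p : ι) : (a p + ε * δ p) * (Real.log (a p + ε * δ p) - 1)
        - a p * (Real.log (a p) - 1) ≤ ε * (δ p * Real.log (a p + ε * δ p)) := by
      by_cases hp : a p = 0
      · rw [hp]
        have := mul_nonneg hε0.le (hδ p hp)
        simp only [zero_add, zero_mul, sub_zero]
        linarith
      · have hap : 0 < a p := lt_of_le_of_ne (ha p) (Ne.symm hp)
        have h1 := Real.log_le_sub_one_of_pos (div_pos (hε p hp) hap)
        rw [Real.log_div (hε p hp).ne' hp] at h1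
        have h2 := mul_le_mul_of_nonneg_left h1 hap.le
        rw [mul_sub, mul_sub, mul_div_cancel₀ _ hp] at h2
        linarith
    have h := hmin ε hε0 hnn
    have h2 := Finset.sum_le_sum fun p (_ : p ∈ Finset.univ) => hterm p
    rw [Finset.sum_sub_distrib, ← Finset.mul_sum] at h2
    exact nonneg_of_mul_nonneg_right (by linarith) hε0
  have hzero : ∀ p, a p = 0 → δ p = 0 := by
    by_contra! hcon
    obtain ⟨q, hq, hq'⟩ := hcon
    have hδq : 0 < δ q := lt_of_le_of_ne (hδ q hq) hq'.symm
    have hub (p : ι) : ∃ C : ℝ, ∀ᶠ ε : ℝ in 𝓝[>] 0, δ p * Real.log (a p + ε * δ p) ≤ C := by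
      by_cases hp : a p = 0
      · refine ⟨0, ?_⟩
        have h1 : ∀ᶠ ε : ℝ in 𝓝[>] 0, a p + ε * δ p < 1 :=
          (hlim p).eventually (gt_mem_nhds (by rw [hp]; exact one_pos))
        filter_upwards [h1, self_mem_nhdsWithin] with ε h1 hε0
        have hε0 : 0 < ε := hε0
        refine mul_nonpos_of_nonneg_of_nonpos (hδ p hp) (Real.log_nonpos ?_ h1.le)
        rw [hp, zero_add]
        exact mul_nonneg hε0.le (hδ p hp)
      · have h1 : Tendsto (fun ε : ℝ => δ p * Real.log (a p + ε * δ p)) (𝓝[>] 0)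
            (𝓝 (δ p * Real.log (a p))) := ((hlim p).log hp).const_mul _
        exact ⟨δ p * Real.log (a p) + 1,
          (h1.eventually (gt_mem_nhds (lt_add_one _))).mono fun _ h => h.le⟩
    choose C hC using hub
    have hbot : Tendsto (fun ε : ℝ => δ q * Real.log (a q + ε * δ q)) (𝓝[>] 0) atBot := by
      refine (Real.tendsto_log_nhdsGT_zero.comp ?_).const_mul_atBot hδq
      refine tendsto_nhdsWithin_iff.2 ⟨hq ▸ hlim q, ?_⟩
      filter_upwards [self_mem_nhdsWithin] with ε hε0
      have hε0 : 0 < ε := hε0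
      show 0 < a q + ε * δ q
      rw [hq, zero_add]
      exact mul_pos hε0 hδq
    obtain ⟨ε, h1, h2, h3⟩ := (hev.and ((eventually_all.2 hC).and
      (hbot.eventually_lt_atBot (-∑ p ∈ Finset.univ.erase q, C p)))).exists
    rw [← Finset.add_sum_erase _ _ (Finset.mem_univ q)] at h1
    have := Finset.sum_le_sum fun p (_ : p ∈ Finset.univ.erase q) => h2 p
    linarith
  refine ⟨hzero, ge_of_tendsto (tendsto_finsetSum _ fun p _ => ?_) hev⟩
  by_cases hp : a p = 0
  · simp [hzero p hp]
  · exact ((hlim p).log hp).const_mul _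

lemma mul_sub_log_nonneg {x y : ℝ} (hx : 0 < x) (hy : 0 < y) :
    0 ≤ (x - y) * (Real.log x - Real.log y) := by
  rcases le_total x y with h | h
  · exact mul_nonneg_of_nonpos_of_nonpos (by linarith)
      (by linarith [Real.log_le_log hx h])
  · exact mul_nonneg (by linarith) (by linarith [Real.log_le_log hy h])

lemma abs_log_sub_log_le {x y b : ℝ} (hb : 0 < b) (hx : b ≤ x) (hy : b ≤ y) :
    |Real.log x - Real.log y| ≤ |x - y| / b := by
  have key {x y : ℝ} (hx : b ≤ x) (hy : b ≤ y) :
      Real.log x - Real.log y ≤ |x - y| / b := by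
    have hx0 := hb.trans_le hx
    have hy0 := hb.trans_le hy
    have h1 := Real.log_le_sub_one_of_pos (div_pos hx0 hy0)
    rw [Real.log_div hx0.ne' hy0.ne'] at h1
    calc Real.log x - Real.log y ≤ x / y - 1 := h1
      _ = (x - y) / y := by field_simp
      _ ≤ |x - y| / y := by gcongr; exact le_abs_self _
      _ ≤ |x - y| / b := by gcongr
  rw [abs_le]
  have h2 := key hy hx
  rw [abs_sub_comm] at h2
  exact ⟨by linarith, key hx hy⟩

/-- Quantitative monotonicity of the logarithm: if testing the logarithmic difference of `g` and
`a` against `g - a` is the same as testing it against a small vector, then `g` is close to `a`. -/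
lemma exists_abs_sub_le_of_log_monotone {ι : Type*} [Fintype ι] (s : Finset ι) {a : ι → ℝ}
    (ha : ∀ p ∈ s, 0 < a p) :
    ∃ K > 0, ∃ ε > 0, ∀ (g z : ι → ℝ) (e : ℝ), (∀ p, 0 < g p) → 0 ≤ e → e ≤ ε →
      (∀ p, |z p| ≤ e) →
      ∑ p ∈ s, (g p - a p) * (Real.log (g p) - Real.log (a p)) =
        ∑ p ∈ s, z p * (Real.log (g p) - Real.log (a p)) →
      ∀ p ∈ s, |g p - a p| ≤ K * e := by
  rcases s.eq_empty_or_nonempty with rfl | hs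
  · exact ⟨1, one_pos, 1, one_pos, by simp⟩
  obtain ⟨p₀, hp₀, hmin⟩ := s.exists_min_image a hs
  obtain ⟨p₁, hp₁, hmax⟩ := s.exists_max_image a hs
  set b := a p₀
  set M := a p₁
  have hb : 0 < b := ha p₀ hp₀
  have hM : 0 < M := ha p₁ hp₁
  have hn : (0 : ℝ) < s.card := by exact_mod_cast hs.card_pos
  set n := (s.card : ℝ)
  refine ⟨M * (2 * (n / (b / 2))), by positivity, b / 2 / n, by positivity, ?_⟩
  intro g z e hg he0 he hz hsum q hq
  obtain ⟨p, hp, hpmax⟩ := s.exists_max_image (fun p => |Real.log (g p) - Real.log (a p)|) hs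
  set u : ι → ℝ := fun p => Real.log (g p) - Real.log (a p) with hu
  have hne : n * e ≤ b / 2 := by
    rw [le_div_iff₀ hn] at he
    linarith
  have h1 : |g p - a p| * |u p| ≤ n * e * |u p| := by
    calc |g p - a p| * |u p| = (g p - a p) * u p := by
          rw [← abs_mul, abs_of_nonneg (mul_sub_log_nonneg (hg p) (ha p hp))]
      _ ≤ ∑ p ∈ s, (g p - a p) * u p :=
          Finset.single_le_sum (f := fun p => (g p - a p) * u p)
            (fun p hp => mul_sub_log_nonneg (hg p) (ha p hp)) hp
      _ = ∑ p ∈ s, z p * u p := hsum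
      _ ≤ ∑ r ∈ s, e * |u p| := by
          refine Finset.sum_le_sum fun r hr => (le_abs_self _).trans ?_
          rw [abs_mul]
          exact mul_le_mul (hz r) (hpmax r hr) (abs_nonneg _) he0
      _ = n * e * |u p| := by rw [Finset.sum_const, nsmul_eq_mul, mul_assoc]
  have hup : |u p| ≤ n / (b / 2) * e := by
    rcases (abs_nonneg (u p)).eq_or_lt with h0 | h0
    · rw [← h0]
      positivity
    · have h2 : |g p - a p| ≤ n * e := le_of_mul_le_mul_right h1 h0
      have hbp : b ≤ a p := hmin p hp
      have h3 : b / 2 ≤ g p := by linarith [(abs_le.1 h2).1]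
      refine (abs_log_sub_log_le (half_pos hb) h3 (by linarith)).trans ?_
      rw [div_mul_eq_mul_div]
      gcongr
  have huq : |u q| ≤ n / (b / 2) * e := (hpmax q hq).trans hup
  have huq1 : |u q| ≤ 1 := by
    refine huq.trans ?_
    rw [div_mul_eq_mul_div, div_le_one (half_pos hb)]
    exact hne
  have haq := ha q hq
  have hgq : g q - a q = a q * (Real.exp (u q) - 1) := by
    rw [hu, Real.exp_sub, Real.exp_log (hg q), Real.exp_log haq]
    field_simp
  rw [hgq, abs_mul, abs_of_pos haq]
  calc a q * |Real.exp (u q) - 1| ≤ M * (2 * (n / (b / 2) * e)) := by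
        gcongr
        · exact hmax q hq
        · exact (Real.abs_exp_sub_one_le huq1).trans (by gcongr)
    _ = M * (2 * (n / (b / 2))) * e := by ring

variable {X Y : Type*} [Fintype X] [Fintype Y]

/-- Stability of the entropy minimizer `a` on a transport polytope: a positive vector whose
logarithm lies, on the support of `a`, in the range of the adjoint marginal map, and which has
almost the right marginals and almost no mass outside `S`, is close to `a`. -/
lemma exists_norm_sub_le_of_marginals {a : X × Y → ℝ} (ha : ∀ p, 0 ≤ a p)
    (S : Set (X × Y))
    (hcone : ∀ δ : X × Y → ℝ, (∀ p, a p = 0 → 0 ≤ δ p) → (∀ p ∉ S, a p = 0 → δ p = 0) →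
      margA δ = 0 → ∀ p, a p = 0 → δ p = 0)
    (hlog : ∀ δ : X × Y → ℝ, (∀ p, a p = 0 → δ p = 0) → margA δ = 0 →
      ∑ p, δ p * Real.log (a p) = 0) :
    ∃ K > 0, ∃ ε > 0, ∀ (g : X × Y → ℝ) (η : (X → ℝ) × (Y → ℝ)) (e : ℝ),
      (∀ p, 0 < g p) → (∀ p, a p ≠ 0 → Real.log (g p) = adjA η p) → 0 ≤ e → e ≤ ε →
      ‖margA g - margA a‖ ≤ e → (∀ p ∉ S, g p ≤ e) → ‖g - a‖ ≤ K * e := by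
  classical
  set m : X × Y → ℝ := fun p => if a p = 0 then 0 else 1 with hm
  set f : (X × Y → ℝ) →ₗ[ℝ] ((X → ℝ) × (Y → ℝ)) :=
    (margLin X Y).comp (LinearMap.mulLeft ℝ m) with hf
  have hf_apply (x : X × Y → ℝ) : f x = margA (m * x) := rfl
  set cone : Set (X × Y → ℝ) :=
    {β | ∀ p, 0 ≤ β p ∧ (a p ≠ 0 → β p = 0) ∧ (p ∉ S → β p = 0)} with hcone_def
  have hclosed : IsClosed cone := by
    simp only [hcone_def, Set.ofPred_forall, Set.ofPred_and]
    refine isClosed_iInter fun p => IsClosed.inter ?_ (IsClosed.inter ?_ ?_)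
    · exact isClosed_le continuous_const (continuous_apply p)
    · exact isClosed_iInter fun _ => isClosed_eq (continuous_apply p) continuous_const
    · exact isClosed_iInter fun _ => isClosed_eq (continuous_apply p) continuous_const
  obtain ⟨C₁, hC₁, hbound₁⟩ := (margLin X Y).exists_norm_le_of_cone (LinearMap.range f) hclosed
    (fun r hr x hx p => by
      obtain ⟨h1, h2, h3⟩ := hx p
      refine ⟨mul_nonneg hr.le h1, fun h => ?_, fun h => ?_⟩
      · simp [h2 h]
      · simp [h3 h])
    (by
      rintro β hβ ⟨x, hx⟩
      have hz := hcone (β - m * x) (fun p hp => ?_) (fun p hpS hp => ?_) ?_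
      · funext p
        by_cases hp : a p = 0
        · simpa [hm, hp] using hz p hp
        · exact (hβ p).2.1 hp
      · simpa [hm, hp] using (hβ p).1
      · simpa [hm, hp] using (hβ p).2.2 hpS
      · rw [margA_sub, ← hf_apply, hx, margLin_apply, sub_self])
  obtain ⟨C₂, hC₂, hbound₂⟩ := f.exists_preimage_norm_le_of_range
  obtain ⟨K₀, hK₀, hnorm⟩ := exists_norm_margA_le (X := X) (Y := Y)
  obtain ⟨K₁, hK₁, ε, hε, hscalar⟩ := exists_abs_sub_le_of_log_monotone
    (Finset.univ.filter fun p => a p ≠ 0) (a := a)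
    (fun p hp => lt_of_le_of_ne (ha p) (Ne.symm (Finset.mem_filter.1 hp).2))
  set D₁ := C₁ * (1 + K₀) with hD₁
  set D₂ := C₂ * (1 + K₀ * D₁ + K₀) with hD₂
  have hD₁0 : 0 < D₁ := by positivity
  have hD₂0 : 0 < D₂ := by positivity
  refine ⟨K₁ * D₂ + D₁ + 1, by positivity, ε / D₂, by positivity, ?_⟩
  intro g η e hg hη he0 heε hmarg hoff
  set σ : X × Y → ℝ := m * (g - a) with hσ
  set β : X × Y → ℝ := fun p => if a p = 0 ∧ p ∈ S then g p else 0 with hβ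
  set o : X × Y → ℝ := fun p => if a p = 0 ∧ p ∉ S then g p else 0 with ho
  have hsplit : g - a = σ + β + o := by
    funext p
    by_cases hp : a p = 0 <;> by_cases hpS : p ∈ S <;>
      simp [hσ, hβ, ho, hm, hp, hpS]
  have ho_norm : ‖o‖ ≤ e := by
    rw [pi_norm_le_iff_of_nonneg he0]
    intro p
    simp only [ho]
    split_ifs with h
    · rw [Real.norm_of_nonneg (hg p).le]
      exact hoff p h.2
    · simpa using he0
  have hAo : ‖margA o‖ ≤ K₀ * e := (hnorm o).trans (by gcongr)
  have hA : margA g - margA a = margA σ + margA β + margA o := by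
    rw [← margA_sub, hsplit, margA_add, margA_add]
  have hβ_norm : ‖β‖ ≤ D₁ * e := by
    have hβmem : β ∈ cone := by
      intro p
      simp only [hβ]
      refine ⟨?_, fun h => if_neg (by tauto), fun h => if_neg (by tauto)⟩
      split_ifs
      exacts [(hg p).le, le_rfl]
    have h1 := hbound₁ β hβmem (margA σ) ⟨g - a, rfl⟩
    rw [margLin_apply] at h1
    have h2 : margA β + margA σ = (margA g - margA a) - margA o := by
      rw [hA]
      abel
    rw [h2] at h1
    calc ‖β‖ ≤ C₁ * (e + K₀ * e) :=
          h1.trans (by gcongr; exact (norm_sub_le _ _).trans (add_le_add hmarg hAo))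
      _ = D₁ * e := by rw [hD₁]; ring
  have hAβ : ‖margA β‖ ≤ K₀ * (D₁ * e) := (hnorm β).trans (by gcongr)
  have hAσ : ‖margA σ‖ ≤ e + K₀ * (D₁ * e) + K₀ * e := by
    have h2 : margA σ = (margA g - margA a) - margA β - margA o := by
      rw [hA]
      abel
    rw [h2]
    exact (norm_sub_le _ _).trans
      (add_le_add ((norm_sub_le _ _).trans (add_le_add hmarg hAβ)) hAo)
  obtain ⟨z, hz, hz_norm⟩ := hbound₂ (g - a)
  have hfσ : f (g - a) = margA σ := rfl
  rw [hfσ] at hz hz_norm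
  have hz_norm' : ‖z‖ ≤ D₂ * e := by
    refine hz_norm.trans ?_
    calc C₂ * ‖margA σ‖ ≤ C₂ * (e + K₀ * (D₁ * e) + K₀ * e) := by gcongr
      _ = D₂ * e := by rw [hD₂]; ring
  have hker : margA (m * (g - a - z)) = 0 := by
    rw [mul_sub, margA_sub, ← hf_apply z, hz, sub_self]
  have hzero : ∑ p, (m * (g - a - z)) p * (Real.log (g p) - Real.log (a p)) = 0 := by
    have h1 : ∑ p, (m * (g - a - z)) p * adjA η p = 0 := by
      rw [← dotE_margA, hker, dotE_comm]
      exact (dotCLM η).map_zero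
    have h2 := hlog _ (fun p hp => by simp [hm, hp]) hker
    rw [← sub_zero (0 : ℝ)]
    nth_rewrite 1 [← h1]
    rw [← h2, ← Finset.sum_sub_distrib]
    refine Finset.sum_congr rfl fun p _ => ?_
    by_cases hp : a p = 0
    · simp [hm, hp]
    · rw [hη p hp]
      ring
  have hS₀ := hscalar g z (D₂ * e) hg (by positivity)
    (by rw [le_div_iff₀ hD₂0] at heε; linarith)
    (fun p => (norm_le_pi_norm z p).trans hz_norm') (by
      rw [← sub_eq_zero, ← Finset.sum_sub_distrib, Finset.sum_filter]
      refine (Finset.sum_congr rfl fun p _ => ?_).trans hzero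
      by_cases hp : a p = 0
      · simp [hm, hp]
      · simp [hm, hp]
        ring)
  rw [pi_norm_le_iff_of_nonneg (by positivity)]
  intro p
  have hKDe : 0 ≤ K₁ * D₂ * e := by positivity
  have hDe : 0 ≤ D₁ * e := by positivity
  rw [Pi.sub_apply, Real.norm_eq_abs]
  by_cases hp : a p = 0
  · rw [hp, sub_zero, abs_of_pos (hg p)]
    by_cases hpS : p ∈ S
    · have h1 := (norm_le_pi_norm β p).trans hβ_norm
      simp only [hβ, hp, hpS, and_self, if_true, Real.norm_of_nonneg (hg p).le] at h1
      linarith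
    · linarith [hoff p hpS]
  · have := hS₀ p (by simp [hp])
    linarith

end ErrorBounds

section Gibbs

variable {X Y : Type*} {c : X × Y → ℝ}

/-- The primal vector associated with a dual vector. -/
noncomputable def gibbs (c : X × Y → ℝ) (t : ℝ) (ξ : (X → ℝ) × (Y → ℝ)) : X × Y → ℝ :=
  fun p => Real.exp (t * (adjA ξ p - c p))

lemma gibbs_pos (t : ℝ) (ξ : (X → ℝ) × (Y → ℝ)) (p : X × Y) : 0 < gibbs c t ξ p :=
  Real.exp_pos _

lemma log_gibbs (t : ℝ) (ξ : (X → ℝ) × (Y → ℝ)) (p : X × Y) :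
    Real.log (gibbs c t ξ p) = t * (adjA ξ p - c p) := Real.log_exp _

end Gibbs

section Duality

open Topology

variable {X Y : Type*} [Fintype X] [Fintype Y] {c : X × Y → ℝ}
  {F : (X → ℝ) × (Y → ℝ) → EReal} {Fs : (X → ℝ) × (Y → ℝ) → ℝ}

lemma exists_dual_sublevel_bound (hF1 : H1 F) (hF4 : H4 F) (hFs : IsConjOf F Fs)
    [Nonempty X] [Nonempty Y] (R : ℝ) :
    ∃ B > 0, ∃ Q > 0, ∀ t : ℝ, 1 ≤ t → ∀ ξ, KtR Fs c t ξ ≤ R →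
      ‖ξ‖ ≤ B ∧ ∀ p, Real.exp (t * (adjA ξ p - c p)) ≤ Q * t := by
  classical
  obtain ⟨W, hW, hWF⟩ := hF4
  obtain ⟨r, hr, hrW⟩ := Metric.mem_nhds_iff.1 hW
  set s := r / 2 with hs
  have hs0 : 0 < s := half_pos hr
  have hfin (v : (X → ℝ) × (Y → ℝ)) (hv : ‖v‖ ≤ s) (h1 : ∀ x, 0 ≤ v.1 x)
      (h2 : ∀ y, 0 ≤ v.2 y) : ∃ M : ℝ, F v = M := by
    have hv' : F v ≠ ⊤ := hWF v (hrW (by rw [mem_ball_zero_iff]; linarith)) h1 h2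
    lift F v to ℝ using ⟨hv', hF1.1 v⟩ with M
    exact ⟨M, rfl⟩
  obtain ⟨M₀, hM₀⟩ := hfin 0 (by simpa using hs0.le) (by simp) (by simp)
  have hex (x : X) := hfin (s • (Pi.single x 1, 0))
    (by simp [norm_smul, Prod.norm_def, Pi.norm_single, abs_of_pos hs0, hs0.le])
    (fun x' => by
      simp only [Prod.smul_fst, Pi.smul_apply, smul_eq_mul, Pi.single_apply]
      split_ifs <;> simp [hs0.le]) (by simp)
  have hey (y : Y) := hfin (s • (0, Pi.single y 1))
    (by simp [norm_smul, Prod.norm_def, Pi.norm_single, abs_of_pos hs0, hs0.le]) (by simp)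
    (fun y' => by
      simp only [Prod.smul_snd, Pi.smul_apply, smul_eq_mul, Pi.single_apply]
      split_ifs <;> simp [hs0.le])
  choose MX hMX using hex
  choose MY hMY using hey
  obtain ⟨M₁, hM₁⟩ := (Set.finite_range MX).bddAbove
  obtain ⟨M₂, hM₂⟩ := (Set.finite_range MY).bddAbove
  set D := (max (max M₁ M₂ + R) 0) / s with hD
  have hD0 : 0 ≤ D := by positivity
  set Q := max (R + M₀) 1 with hQ
  have hQ0 : 0 < Q := lt_max_of_lt_right one_pos
  refine ⟨D + Q + ‖c‖, by positivity, Q, hQ0, fun t ht ξ hξ => ?_⟩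
  have ht0 : 0 < t := one_pos.trans_le ht
  have hexp0 (p : X × Y) : 0 ≤ Real.exp (t * (adjA ξ p - c p)) := (Real.exp_pos _).le
  have hsum0 : 0 ≤ (1 / t) * ∑ p, Real.exp (t * (adjA ξ p - c p)) :=
    mul_nonneg (by positivity) (Finset.sum_nonneg fun p _ => hexp0 p)
  unfold KtR at hξ
  have hlowX (x : X) : -ξ.1 x ≤ D := by
    have h1 := fenchel_young_real hF1 hFs (hMX x) (-ξ)
    rw [dotE_comm, dotE_smul_right, dotE_single_fst, Prod.fst_neg, Pi.neg_apply] at h1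
    have h2 := hM₁ ⟨x, rfl⟩
    rw [hD, le_div_iff₀ hs0]
    have h3 := le_max_left M₁ M₂
    refine le_trans ?_ (le_max_left _ _)
    linarith
  have hlowY (y : Y) : -ξ.2 y ≤ D := by
    have h1 := fenchel_young_real hF1 hFs (hMY y) (-ξ)
    rw [dotE_comm, dotE_smul_right, dotE_single_snd, Prod.snd_neg, Pi.neg_apply] at h1
    have h2 := hM₂ ⟨y, rfl⟩
    rw [hD, le_div_iff₀ hs0]
    have h3 := le_max_right M₁ M₂
    refine le_trans ?_ (le_max_left _ _)
    linarith
  have hexp (p : X × Y) : Real.exp (t * (adjA ξ p - c p)) ≤ Q * t := by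
    have h1 := fenchel_young_real hF1 hFs hM₀ (-ξ)
    rw [dotE_comm, ← dotCLM_apply, map_zero] at h1
    have h2 := Finset.single_le_sum (fun p _ => hexp0 p) (Finset.mem_univ p)
    have h3 : (1 / t) * ∑ p, Real.exp (t * (adjA ξ p - c p)) ≤ Q :=
      le_trans (by linarith) (le_max_left _ _)
    rw [one_div, inv_mul_eq_div, div_le_iff₀ ht0] at h3
    exact h2.trans h3
  refine ⟨?_, hexp⟩
  have hup (p : X × Y) : ξ.1 p.1 + ξ.2 p.2 ≤ Q + ‖c‖ := by
    have h1 := (Real.add_one_le_exp (t * (adjA ξ p - c p))).trans (hexp p)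
    have h2 : t * (adjA ξ p - c p) ≤ t * Q := by linarith
    have h3 := le_of_mul_le_mul_left h2 ht0
    have h4 := (le_abs_self _).trans (norm_le_pi_norm c p)
    simp only [adjA] at h3
    linarith
  have hc0 := norm_nonneg c
  rw [Prod.norm_def, max_le_iff, pi_norm_le_iff_of_nonneg (by positivity),
    pi_norm_le_iff_of_nonneg (by positivity)]
  constructor
  · intro x
    obtain ⟨y⟩ := ‹Nonempty Y›
    have h1 := hlowX x
    have h2 := hlowY y
    have h3 := hup (x, y)
    rw [Real.norm_eq_abs, abs_le]
    constructor <;> linarith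
  · intro y
    obtain ⟨x⟩ := ‹Nonempty X›
    have h1 := hlowX x
    have h2 := hlowY y
    have h3 := hup (x, y)
    rw [Real.norm_eq_abs, abs_le]
    constructor <;> linarith

lemma KtR_le_of_feasible {t : ℝ} (ht : 0 < t) {ξ : (X → ℝ) × (Y → ℝ)}
    (hξ : ∀ p, adjA ξ p ≤ c p) :
    KtR Fs c t ξ ≤ Fs (-ξ) + Fintype.card (X × Y) / t := by
  have h1 : ∑ p, Real.exp (t * (adjA ξ p - c p)) ≤ ∑ _p : X × Y, (1 : ℝ) := by
    refine Finset.sum_le_sum fun p _ => Real.exp_le_one_iff.2 ?_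
    exact mul_nonpos_of_nonneg_of_nonpos ht.le (by linarith [hξ p])
  rw [Finset.sum_const, nsmul_eq_mul, mul_one, Finset.card_univ] at h1
  unfold KtR
  rw [one_div, inv_mul_eq_div]
  gcongr

lemma continuous_KtR (hf : Continuous Fs) (t : ℝ) : Continuous (KtR Fs c t) := by
  unfold KtR
  have h (p : X × Y) := continuous_adjA p
  fun_prop

lemma exists_dual_minimizers (hF1 : H1 F) (hF4 : H4 F) (hFs : IsConjOf F Fs)
    [Nonempty X] [Nonempty Y] (hf : Continuous Fs) (hc : ∀ p, 0 ≤ c p) :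
    ∃ B > 0, ∃ Q > 0, ∀ t : ℝ, 1 ≤ t → ∃ ξ, ‖ξ‖ ≤ B ∧
      (∀ p, Real.exp (t * (adjA ξ p - c p)) ≤ Q * t) ∧ ∀ ξ', KtR Fs c t ξ ≤ KtR Fs c t ξ' := by
  set R := Fs 0 + Fintype.card (X × Y) with hR
  obtain ⟨B, hB, Q, hQ, h⟩ := exists_dual_sublevel_bound (c := c) hF1 hF4 hFs R
  refine ⟨B, hB, Q, hQ, fun t ht => ?_⟩
  have ht0 : 0 < t := one_pos.trans_le ht
  have h0 : KtR Fs c t 0 ≤ R := by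
    refine (KtR_le_of_feasible ht0 (ξ := 0) (by simpa [adjA] using hc)).trans ?_
    rw [neg_zero, hR]
    gcongr
    exact div_le_self (Nat.cast_nonneg _) ht
  obtain ⟨ξ, hξ, hmin⟩ := (isCompact_closedBall (0 : (X → ℝ) × (Y → ℝ)) B).exists_isMinOn
    ⟨0, Metric.mem_closedBall_self hB.le⟩ (continuous_KtR (c := c) hf t).continuousOn
  have hglob (ξ' : (X → ℝ) × (Y → ℝ)) : KtR Fs c t ξ ≤ KtR Fs c t ξ' := by
    rcases le_total (KtR Fs c t ξ') R with h1 | h1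
    · exact hmin (mem_closedBall_zero_iff.2 (h t ht ξ' h1).1)
    · exact (hmin (Metric.mem_closedBall_self hB.le)).trans (h0.trans h1)
  exact ⟨ξ, mem_closedBall_zero_iff.1 hξ, (h t ht ξ ((hglob 0).trans h0)).2, hglob⟩

lemma fderiv_eq_of_dual_minimizer (hf : Differentiable ℝ Fs) {t : ℝ} (ht : 0 < t)
    {ξ : (X → ℝ) × (Y → ℝ)} (hξ : ∀ ξ', KtR Fs c t ξ ≤ KtR Fs c t ξ') :
    fderiv ℝ Fs (-ξ) = dotCLM (margA (gibbs c t ξ)) := by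
  refine ContinuousLinearMap.ext fun d => ?_
  rw [dotCLM_apply, dotE_margA]
  have hline : HasDerivAt (fun s : ℝ => -(ξ + s • d)) (-d) 0 := by
    have h := (((hasDerivAt_id (0 : ℝ)).smul_const d).const_add ξ).fun_neg
    rw [one_smul] at h
    exact h
  have h1 : HasDerivAt (fun s : ℝ => Fs (-(ξ + s • d))) (fderiv ℝ Fs (-ξ) (-d)) 0 := by
    have h := (hf (-(ξ + (0 : ℝ) • d))).hasFDerivAt.comp_hasDerivAt (0 : ℝ) hline
    rw [zero_smul, add_zero] at h
    exact h
  have h2 (p : X × Y) : HasDerivAt (fun s : ℝ => Real.exp (t * (adjA (ξ + s • d) p - c p)))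
      (gibbs c t ξ p * (t * adjA d p)) 0 := by
    have h : HasDerivAt (fun s : ℝ => t * (adjA ξ p + s * adjA d p - c p))
        (t * adjA d p) 0 := by
      simpa using ((((hasDerivAt_id (0 : ℝ)).mul_const (adjA d p)).const_add
        (adjA ξ p)).sub_const (c p)).const_mul t
    have h' := h.exp
    simp only [zero_mul, add_zero] at h'
    refine h'.congr_of_eventuallyEq (Filter.Eventually.of_forall fun s => ?_)
    simp only [adjA, Prod.fst_add, Prod.snd_add, Prod.smul_fst, Prod.smul_snd, Pi.add_apply,
      Pi.smul_apply, smul_eq_mul]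
    ring_nf
  have h3 : HasDerivAt (fun s : ℝ => KtR Fs c t (ξ + s • d))
      (fderiv ℝ Fs (-ξ) (-d) + 1 / t * ∑ p, gibbs c t ξ p * (t * adjA d p)) 0 := by
    unfold KtR
    exact h1.add ((HasDerivAt.fun_sum fun p _ => h2 p).const_mul (1 / t))
  have hmin : IsLocalMin (fun s : ℝ => KtR Fs c t (ξ + s • d)) 0 :=
    Filter.Eventually.of_forall fun s => by simpa using hξ (ξ + s • d)
  have h4 := hmin.hasDerivAt_eq_zero h3
  have h5 : 1 / t * ∑ p, gibbs c t ξ p * (t * adjA d p) = ∑ p, gibbs c t ξ p * adjA d p := by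
    rw [Finset.mul_sum]
    refine Finset.sum_congr rfl fun p _ => ?_
    field_simp
  rw [h5, map_neg] at h4
  linarith

lemma fenchel_eq_of_dual_minimizer (hF1 : H1 F) (hF3 : H3 F) (hFs : IsConjOf F Fs)
    (hf : Differentiable ℝ Fs) {t : ℝ} (ht : 0 < t)
    {ξ : (X → ℝ) × (Y → ℝ)} (hξ : ∀ ξ', KtR Fs c t ξ ≤ KtR Fs c t ξ') :
    F (margA (gibbs c t ξ)) = ((dotE (margA (gibbs c t ξ)) (-ξ) - Fs (-ξ) : ℝ) : EReal) := by
  obtain ⟨v, hv⟩ := exists_fenchel_eq hF1 hF3 hFs (-ξ)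
  have h1 := fderiv_eq_dotCLM_of_subgradient hf (subgradient_of_fenchel_eq hF1 hFs hv)
  rw [fderiv_eq_of_dual_minimizer hf ht hξ] at h1
  have h2 : margA (gibbs c t ξ) = v := dotE_left_injective fun d => by
    simpa only [dotCLM_apply] using DFunLike.congr_fun h1 d
  rw [h2, hv]

lemma entropy_gap_nonneg {x y : ℝ} (hx : 0 ≤ x) (hy : 0 < y) :
    0 ≤ x * (Real.log x - 1) - x * Real.log y + y ∧
      (x * (Real.log x - 1) - x * Real.log y + y = 0 → x = y) := by
  have key : x * (Real.log x - 1) - x * Real.log y + y =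
      y * InformationTheory.klFun (x / y) := by
    unfold InformationTheory.klFun
    rcases hx.eq_or_lt with rfl | hx
    · simp
    · rw [Real.log_div hx.ne' hy.ne']
      field_simp
      ring
  have hxy : 0 ≤ x / y := div_nonneg hx hy.le
  rw [key]
  refine ⟨mul_nonneg hy.le (InformationTheory.klFun_nonneg hxy), fun h => ?_⟩
  rw [mul_eq_zero_iff_left hy.ne', InformationTheory.klFun_eq_zero_iff hxy,
    div_eq_one_iff_eq hy.ne'] at h
  exact h

lemma eq_gibbs_of_minimizer (hF1 : H1 F) (hF3 : H3 F) (hFs : IsConjOf F Fs)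
    (hf : Differentiable ℝ Fs) {t : ℝ} (ht : 0 < t)
    {ξ : (X → ℝ) × (Y → ℝ)} (hξ : ∀ ξ', KtR Fs c t ξ ≤ KtR Fs c t ξ')
    {g : X × Y → ℝ} (hg : ∀ γ, Ct F c t g ≤ Ct F c t γ) : g = gibbs c t ξ := by
  set b := gibbs c t ξ with hb
  have hb0 (p : X × Y) : 0 < b p := gibbs_pos t ξ p
  have hCb : Ct F c t b = ((dotP c b + (dotE (margA b) (-ξ) - Fs (-ξ)) +
      1 / t * ∑ p, b p * (Real.log (b p) - 1) : ℝ) : EReal) := by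
    unfold Ct ent
    rw [if_pos fun p => (hb0 p).le, fenchel_eq_of_dual_minimizer hF1 hF3 hFs hf ht hξ]
    norm_cast
  have hle := hg b
  rw [hCb] at hle
  have hFg := hF1.1 (margA g)
  have ht' : 0 < 1 / t := by positivity
  have hg0 : ∀ p, 0 ≤ g p := by
    by_contra hcon
    unfold Ct ent at hle
    rw [if_neg hcon, EReal.coe_mul_top_of_pos ht', EReal.add_top_of_ne_bot, top_le_iff] at hle
    · exact EReal.coe_ne_top _ hle
    · rw [ne_eq, EReal.add_eq_bot_iff]
      simp [hFg]
  have hlow : ((dotP c g + (dotE (margA g) (-ξ) - Fs (-ξ)) +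
      1 / t * ∑ p, g p * (Real.log (g p) - 1) : ℝ) : EReal) ≤ Ct F c t g := by
    unfold Ct ent
    rw [if_pos hg0]
    push_cast [← EReal.coe_sub]
    gcongr
    have := fenchel_young hF1 hFs (margA g) (-ξ)
    push_cast at this
    exact this
  have hreal := hlow.trans hle
  rw [EReal.coe_le_coe_iff, dotE_neg_right, dotE_neg_right, dotE_margA, dotE_margA] at hreal
  have hexpand (γ : X × Y → ℝ) : t * (dotP c γ - ∑ p, γ p * adjA ξ p) +
      ∑ p, γ p * (Real.log (γ p) - 1) =
      ∑ p, (γ p * (Real.log (γ p) - 1) - γ p * Real.log (b p) + b p) - ∑ p, b p := by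
    rw [dotP, ← Finset.sum_sub_distrib, Finset.mul_sum, ← Finset.sum_add_distrib,
      ← Finset.sum_sub_distrib]
    refine Finset.sum_congr rfl fun p _ => ?_
    rw [hb, log_gibbs]
    ring
  have hmul (γ : X × Y → ℝ) : t * (dotP c γ - ∑ p, γ p * adjA ξ p) +
      ∑ p, γ p * (Real.log (γ p) - 1) = t * ((dotP c γ + (-∑ p, γ p * adjA ξ p - Fs (-ξ)) +
      1 / t * ∑ p, γ p * (Real.log (γ p) - 1)) + Fs (-ξ)) := by
    field_simp
    ring
  have hgb : ∑ p, (g p * (Real.log (g p) - 1) - g p * Real.log (b p) + b p) ≤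
      ∑ p, (b p * (Real.log (b p) - 1) - b p * Real.log (b p) + b p) := by
    have h1 := hexpand g
    have h2 := hexpand b
    rw [hmul] at h1 h2
    have h3 := mul_le_mul_of_nonneg_left (add_le_add_left hreal (Fs (-ξ))) ht.le
    linarith
  have hzero : ∑ p, (b p * (Real.log (b p) - 1) - b p * Real.log (b p) + b p) = 0 :=
    Finset.sum_eq_zero fun p _ => by ring
  rw [hzero] at hgb
  have hnn : ∀ p ∈ Finset.univ,
      0 ≤ g p * (Real.log (g p) - 1) - g p * Real.log (b p) + b p :=
    fun p _ => (entropy_gap_nonneg (hg0 p) (hb0 p)).1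
  have := (Finset.sum_eq_zero_iff_of_nonneg hnn).1 (le_antisymm hgb (Finset.sum_nonneg hnn))
  funext p
  exact (entropy_gap_nonneg (hg0 p) (hb0 p)).2 (this p (Finset.mem_univ p))

end Duality

section Rates

open Topology

variable {X Y : Type*} [Fintype X] [Fintype Y] {c : X × Y → ℝ}
  {F : (X → ℝ) × (Y → ℝ) → EReal} {Fs : (X → ℝ) × (Y → ℝ) → ℝ} {γs : X × Y → ℝ}

/-- Existence of a Kantorovich potential satisfying strong duality and complementary slackness,
obtained as a limit of minimizers of the regularized dual problems. -/
lemma exists_dual_optimum [Nonempty X] [Nonempty Y] (hc : ∀ p, 0 ≤ c p)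
    (hF1 : H1 F) (hF3 : H3 F) (hF4 : H4 F) (hFs : IsConjOf F Fs) (hf : Differentiable ℝ Fs)
    (hγs0 : ∀ p, 0 ≤ γs p)
    (hγsopt : ∀ γ : X × Y → ℝ, (∀ p, 0 ≤ γ p) →
      ((dotP c γs : ℝ) : EReal) + F (margA γs) ≤ ((dotP c γ : ℝ) : EReal) + F (margA γ)) :
    ∃ ξs, (∀ p, adjA ξs p ≤ c p) ∧ (∀ p, γs p * (c p - adjA ξs p) = 0) ∧
      F (margA γs) = ((dotE (margA γs) (-ξs) - Fs (-ξs) : ℝ) : EReal) := by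
  obtain ⟨B, hB, Q, hQ, hdual⟩ := exists_dual_minimizers hF1 hF4 hFs hf.continuous hc
  have hopt (t : ℝ) (ht : 0 < t) (ξ : (X → ℝ) × (Y → ℝ))
      (hξ : ∀ ξ', KtR Fs c t ξ ≤ KtR Fs c t ξ') :
      ((dotP c γs : ℝ) : EReal) + F (margA γs) ≤
        ((Fintype.card (X × Y) / t - Fs (-ξ) : ℝ) : EReal) := by
    refine (hγsopt (gibbs c t ξ) fun p => (gibbs_pos t ξ p).le).trans ?_
    rw [fenchel_eq_of_dual_minimizer hF1 hF3 hFs hf ht hξ, ← EReal.coe_add,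
      EReal.coe_le_coe_iff, dotE_neg_right, dotE_margA, dotP]
    have h1 : ∑ p, (c p * gibbs c t ξ p - gibbs c t ξ p * adjA ξ p) ≤
        ∑ _p : X × Y, 1 / t := by
      refine Finset.sum_le_sum fun p _ => ?_
      have hb := gibbs_pos (c := c) t ξ p
      have h2 := Real.one_sub_inv_le_log_of_pos hb
      have h3 := mul_le_mul_of_nonneg_left h2 hb.le
      rw [mul_sub, mul_inv_cancel₀ hb.ne', log_gibbs] at h3
      rw [le_div_iff₀ ht]
      linarith
    rw [Finset.sum_const, nsmul_eq_mul, Finset.card_univ, Finset.sum_sub_distrib,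
      mul_one_div] at h1
    linarith
  obtain ⟨M, hM⟩ : ∃ M : ℝ, F (margA γs) = M := by
    obtain ⟨ξ, -, -, hξ⟩ := hdual 1 le_rfl
    have h1 := hopt 1 one_pos ξ hξ
    have h2 : F (margA γs) ≠ ⊤ := by
      intro h
      rw [h, EReal.coe_add_top, top_le_iff] at h1
      exact EReal.coe_ne_top _ h1
    lift F (margA γs) to ℝ using ⟨h2, hF1.1 _⟩ with M
    exact ⟨M, rfl⟩
  choose ξ hξB hξQ hξmin using fun n : ℕ => hdual (n + 1) (by
    have : (0 : ℝ) ≤ n := Nat.cast_nonneg n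
    linarith)
  obtain ⟨ξs, -, φ, hφ, hlim⟩ := (isCompact_closedBall (0 : (X → ℝ) × (Y → ℝ)) B).tendsto_subseq
    fun n => mem_closedBall_zero_iff.2 (hξB n)
  have hn0 (n : ℕ) : (0 : ℝ) < n + 1 := by positivity
  have hdecay (K : ℝ) : Tendsto (fun n => K / ((φ n : ℝ) + 1)) atTop (𝓝 0) := by
    refine Tendsto.const_div_atTop ?_ K
    exact tendsto_atTop_add_const_right _ _
      (tendsto_natCast_atTop_atTop.comp hφ.tendsto_atTop)
  have hfeas (p : X × Y) : adjA ξs p ≤ c p := by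
    have h1 (n : ℕ) : (max (adjA (ξ (φ n)) p - c p) 0) ^ 2 ≤ 2 * Q / ((φ n : ℝ) + 1) := by
      set u := adjA (ξ (φ n)) p - c p
      have hp := hn0 (φ n)
      rcases le_total u 0 with h | h
      · rw [max_eq_right h, zero_pow two_ne_zero]
        positivity
      · rw [max_eq_left h, le_div_iff₀ hp]
        have h2 := (Real.quadratic_le_exp_of_nonneg (mul_nonneg hp.le h)).trans (hξQ (φ n) p)
        have h3 : ((φ n : ℝ) + 1) * (u ^ 2 * ((φ n : ℝ) + 1)) ≤ ((φ n : ℝ) + 1) * (2 * Q) := by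
          nlinarith [mul_nonneg hp.le h]
        exact le_of_mul_le_mul_left h3 hp
    have h2 : Continuous fun ζ : (X → ℝ) × (Y → ℝ) => (max (adjA ζ p - c p) 0) ^ 2 :=
      (((continuous_adjA p).sub continuous_const).max continuous_const).pow 2
    have h3 := le_of_tendsto_of_tendsto' ((h2.tendsto ξs).comp hlim) (hdecay (2 * Q)) h1
    have h4 : max (adjA ξs p - c p) 0 = 0 := by
      simpa using le_antisymm h3 (sq_nonneg _)
    linarith [le_max_left (adjA ξs p - c p) 0]
  have hval : dotP c γs + M ≤ -Fs (-ξs) := by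
    have h1 (n : ℕ) : dotP c γs + M ≤
        Fintype.card (X × Y) / ((φ n : ℝ) + 1) - Fs (-ξ (φ n)) := by
      have := hopt _ (hn0 (φ n)) (ξ (φ n)) (hξmin (φ n))
      rw [hM] at this
      exact_mod_cast this
    have h2 : Tendsto (fun n => Fs (-ξ (φ n))) atTop (𝓝 (Fs (-ξs))) :=
      ((hf.continuous.comp continuous_neg).tendsto ξs).comp hlim
    have h3 := ge_of_tendsto' ((hdecay (Fintype.card (X × Y))).sub h2) h1
    rwa [zero_sub] at h3
  have hFY := fenchel_young_real hF1 hFs hM (-ξs)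
  have hterm : ∀ p ∈ Finset.univ, 0 ≤ γs p * (c p - adjA ξs p) :=
    fun p _ => mul_nonneg (hγs0 p) (sub_nonneg.2 (hfeas p))
  have hslack : ∑ p, γs p * (c p - adjA ξs p) = dotP c γs + dotE (margA γs) (-ξs) := by
    rw [dotE_neg_right, dotE_margA, dotP, ← sub_eq_add_neg, ← Finset.sum_sub_distrib]
    exact Finset.sum_congr rfl fun p _ => by ring
  have hsum0 := Finset.sum_nonneg hterm
  refine ⟨ξs, hfeas, fun p => ?_, ?_⟩
  · exact (Finset.sum_eq_zero_iff_of_nonneg hterm).1 (by linarith) p (Finset.mem_univ p)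
  · rw [hM]
    norm_cast
    linarith

lemma mul_sub_exp_le_sq {a x : ℝ} (ha : 0 ≤ a) : a * x - Real.exp x ≤ a ^ 2 := by
  rcases le_total x 0 with h | h
  · nlinarith [Real.exp_pos x, mul_nonneg ha (neg_nonneg.2 h), sq_nonneg a]
  · nlinarith [Real.quadratic_le_exp_of_nonneg h, sq_nonneg (a - x), sq_nonneg a]

lemma div_sqrt_le_of_sq_le {C ε t : ℝ} (hC : 0 < C) (hε : 0 < ε) (h : (C / ε) ^ 2 ≤ t) :
    C / √t ≤ ε := by
  have h1 : C / ε ≤ √t := Real.le_sqrt_of_sq_le h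
  have h2 : 0 < √t := (div_pos hC hε).trans_le h1
  rw [div_le_iff₀ hε] at h1
  rw [div_le_iff₀ h2]
  linarith

/-- The dual trajectory converges at rate `1/√t`. -/
lemma exists_dual_rate (hF1 : H1 F) (hF3 : H3 F) (hFs : IsConjOf F Fs)
    (hf : Differentiable ℝ Fs) (hF5 : H5 Fs) (hγs0 : ∀ p, 0 ≤ γs p)
    {ξs : (X → ℝ) × (Y → ℝ)} (hfeas : ∀ p, adjA ξs p ≤ c p)
    (hslack : ∀ p, γs p * (c p - adjA ξs p) = 0)
    (hval : F (margA γs) = ((dotE (margA γs) (-ξs) - Fs (-ξs) : ℝ) : EReal)) :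
    ∃ C > 0, ∃ T : ℝ, 1 ≤ T ∧ ∀ t, T ≤ t → ∀ ξ, (∀ ξ', KtR Fs c t ξ ≤ KtR Fs c t ξ') →
      ‖ξ - ξs‖ ≤ C / √t := by
  obtain ⟨r, hr, g, lam, hlam, hsub, hstrong⟩ := hF5 (-ξs)
  have hg : g = margA γs := by
    have h1 := fderiv_eq_dotCLM_of_subgradient hf hsub
    rw [fderiv_eq_dotCLM_of_subgradient hf (subgradient_of_fenchel_eq hF1 hFs hval)] at h1
    exact dotE_left_injective fun d => (DFunLike.congr_fun h1 d).symm
  set C₀ : ℝ := Fintype.card (X × Y) + ∑ p, γs p ^ 2 + 1 with hC₀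
  have hC₀pos : 0 < C₀ := by positivity
  refine ⟨√(2 * C₀ / lam), by positivity, 2 * C₀ / (lam * r ^ 2) + 1,
    le_add_of_nonneg_left (by positivity), fun t ht ξ hξ => ?_⟩
  have hT : 0 < 2 * C₀ / (lam * r ^ 2) := by positivity
  have ht0 : 0 < t := by linarith
  set d := -ξ - -ξs with hd
  have hgap : Fs (-ξ) - Fs (-ξs) - dotE g d ≤ C₀ / t := by
    have h1 := (hξ ξs).trans (KtR_le_of_feasible ht0 hfeas)
    unfold KtR at h1
    have h2 : dotE g d = -∑ p, γs p * (adjA ξ p - c p) := by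
      rw [hg, hd, dotE_sub_right, dotE_neg_right, dotE_neg_right, dotE_margA, dotE_margA,
        ← sub_eq_zero]
      have h3 : ∑ p, γs p * (c p - adjA ξs p) = 0 := Finset.sum_eq_zero fun p _ => hslack p
      simp only [mul_sub, Finset.sum_sub_distrib] at h3 ⊢
      linarith
    have h3 : ∑ p, (γs p * (t * (adjA ξ p - c p)) - Real.exp (t * (adjA ξ p - c p))) ≤
        ∑ p, γs p ^ 2 := Finset.sum_le_sum fun p _ => mul_sub_exp_le_sq (hγs0 p)
    rw [Finset.sum_sub_distrib] at h3
    have h4 : ∑ p, γs p * (t * (adjA ξ p - c p)) = t * ∑ p, γs p * (adjA ξ p - c p) := by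
      rw [Finset.mul_sum]
      exact Finset.sum_congr rfl fun p _ => by ring
    rw [h4] at h3
    rw [h2, le_div_iff₀ ht0]
    have h5 := mul_le_mul_of_nonneg_right h1 ht0.le
    rw [add_mul, add_mul, div_mul_cancel₀ _ ht0.ne', one_div, inv_mul_eq_div,
      div_mul_cancel₀ _ ht0.ne'] at h5
    linarith
  have hdr : ‖d‖ ≤ r := by
    by_contra! hcon
    have hd0 : 0 < ‖d‖ := hr.trans hcon
    set s := r / ‖d‖ with hs
    have hs0 : 0 < s := by positivity
    have hs1 : s ≤ 1 := (div_le_one hd0).2 hcon.le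
    have hnorm : ‖s • d‖ = r := by
      rw [norm_smul, Real.norm_of_nonneg hs0.le, hs, div_mul_cancel₀ _ hd0.ne']
    have h1 := hstrong (-ξs + s • d) (by rw [add_sub_cancel_left, hnorm])
    rw [add_sub_cancel_left, hnorm, dotE_smul_right] at h1
    have h2 := (convexOn_of_isConjOf hF1 hF3 hFs).2 (Set.mem_univ (-ξs)) (Set.mem_univ (-ξ))
      (sub_nonneg.2 hs1) hs0.le (by ring)
    have h3 : (1 - s) • -ξs + s • -ξ = -ξs + s • d := by
      rw [hd]
      module
    rw [h3, smul_eq_mul, smul_eq_mul] at h2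
    have h4 : lam / 2 * r ^ 2 ≤ C₀ / t := by
      have h5 : 0 ≤ Fs (-ξ) - Fs (-ξs) - dotE g d := by linarith [hsub (-ξ)]
      have h6 := mul_le_mul_of_nonneg_right hs1 h5
      linarith
    rw [le_div_iff₀ ht0] at h4
    have h5 : 2 * C₀ / (lam * r ^ 2) < t := by linarith
    rw [div_lt_iff₀ (by positivity)] at h5
    linarith
  have hquad := hstrong (-ξ) hdr
  have hdξ : ‖ξ - ξs‖ = ‖d‖ := by
    rw [hd, ← norm_neg]
    congr 1
    abel
  rw [hdξ, ← Real.sqrt_div (by positivity)]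
  refine Real.le_sqrt_of_sq_le ?_
  have h1 : lam / 2 * ‖d‖ ^ 2 ≤ C₀ / t := by linarith
  rw [le_div_iff₀ ht0] at h1
  rw [le_div_iff₀ ht0, le_div_iff₀ hlam]
  linarith

/-- Minimality of the entropy among optimal plans, in terms of directions preserving the
marginals. -/
lemma first_order_of_minimal_entropy (hγs0 : ∀ p, 0 ≤ γs p)
    (hγsopt : ∀ γ : X × Y → ℝ, (∀ p, 0 ≤ γ p) →
      ((dotP c γs : ℝ) : EReal) + F (margA γs) ≤ ((dotP c γ : ℝ) : EReal) + F (margA γ))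
    (hγsent : ∀ γ' : X × Y → ℝ,
      ((∀ p, 0 ≤ γ' p) ∧
        ∀ γ : X × Y → ℝ, (∀ p, 0 ≤ γ p) →
          ((dotP c γ' : ℝ) : EReal) + F (margA γ') ≤
            ((dotP c γ : ℝ) : EReal) + F (margA γ)) →
      ent γs ≤ ent γ')
    {ξs : (X → ℝ) × (Y → ℝ)} (hslack : ∀ p, γs p * (c p - adjA ξs p) = 0)
    {δ : X × Y → ℝ} (hδ : ∀ p, γs p = 0 → 0 ≤ δ p)
    (hδS : ∀ p, adjA ξs p ≠ c p → γs p = 0 → δ p = 0) (hker : margA δ = 0) :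
    (∀ p, γs p = 0 → δ p = 0) ∧ 0 ≤ ∑ p, δ p * Real.log (γs p) := by
  refine entropy_first_order hγs0 hδ fun ε hε hnn => ?_
  have hcost : dotP c δ = 0 := by
    have h1 : dotP c δ = ∑ p, δ p * adjA ξs p := by
      refine Finset.sum_congr rfl fun p _ => ?_
      by_cases hp : adjA ξs p = c p
      · rw [hp, mul_comm]
      · have h2 : γs p = 0 :=
          (mul_eq_zero.1 (hslack p)).resolve_right (sub_ne_zero.2 (Ne.symm hp))
        rw [hδS p hp h2, mul_zero, zero_mul]
    rw [h1, ← dotE_margA, hker, dotE_comm]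
    exact (dotCLM ξs).map_zero
  have hmarg : margA (γs + ε • δ) = margA γs := by
    rw [margA_add, margA_smul, hker, smul_zero, add_zero]
  have hdot : dotP c (γs + ε • δ) = dotP c γs := by
    have : dotP c (γs + ε • δ) = dotP c γs + ε * dotP c δ := by
      simp only [dotP, Pi.add_apply, Pi.smul_apply, smul_eq_mul, mul_add,
        Finset.sum_add_distrib, Finset.mul_sum]
      congr 1
      exact Finset.sum_congr rfl fun p _ => by ring
    rw [this, hcost, mul_zero, add_zero]
  have h := hγsent (γs + ε • δ) ⟨hnn, by rwa [hmarg, hdot]⟩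
  unfold ent at h
  rw [if_pos hγs0, if_pos (show ∀ p, 0 ≤ (γs + ε • δ) p from hnn)] at h
  exact_mod_cast h

end Rates

/-- the primal trajectory converges at rate at least `1/√t`:
`‖γ(t) − γ*‖ ≤ C/√t` for large `t`, where `γ*` is the minimal-entropy
minimizer of the unbalanced OT problem. -/
theorem statement18 {X Y : Type*} [Fintype X] [Fintype Y] [Nonempty X] [Nonempty Y]
    (c : X × Y → ℝ) (hc : ∀ p, 0 ≤ c p)
    (F : (X → ℝ) × (Y → ℝ) → EReal) (Fs : (X → ℝ) × (Y → ℝ) → ℝ)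
    (hF1 : H1 F) (hF2 : H2 F) (hF3 : H3 F) (hF4 : H4 F)
    (hFs : IsConjOf F Fs) (hF5 : H5 Fs) (hF6 : ContDiff ℝ 2 Fs)
    (gam : ℝ → X × Y → ℝ)
    (hgam : ∀ t : ℝ, 0 < t → ∀ γ : X × Y → ℝ, Ct F c t (gam t) ≤ Ct F c t γ)
    (γs : X × Y → ℝ) (hγs0 : ∀ p, 0 ≤ γs p)
    (hγsopt : ∀ γ : X × Y → ℝ, (∀ p, 0 ≤ γ p) →
      ((dotP c γs : ℝ) : EReal) + F (margA γs) ≤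
        ((dotP c γ : ℝ) : EReal) + F (margA γ))
    (hγsent : ∀ γ' : X × Y → ℝ,
      ((∀ p, 0 ≤ γ' p) ∧
        ∀ γ : X × Y → ℝ, (∀ p, 0 ≤ γ p) →
          ((dotP c γ' : ℝ) : EReal) + F (margA γ') ≤
            ((dotP c γ : ℝ) : EReal) + F (margA γ)) →
      ent γs ≤ ent γ') :
    ∃ C > (0 : ℝ), ∃ T > (0 : ℝ), ∀ t : ℝ, T ≤ t →
      ‖gam t - γs‖ ≤ C / Real.sqrt t := by
  have hdiff : Differentiable ℝ Fs := hF6.differentiable (by norm_num)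
  obtain ⟨ξs, hfeas, hslack, hval⟩ := exists_dual_optimum hc hF1 hF3 hF4 hFs hdiff hγs0 hγsopt
  obtain ⟨_, _, _, _, hdual⟩ := exists_dual_minimizers hF1 hF4 hFs hdiff.continuous hc
  obtain ⟨C₁, hC₁, T₁, hT₁, hrate⟩ :=
    exists_dual_rate hF1 hF3 hFs hdiff hF5 hγs0 hfeas hslack hval
  obtain ⟨K, hK, ε, hε, hstab⟩ := exists_norm_sub_le_of_marginals hγs0
    {p | adjA ξs p = c p}
    (fun δ hδ hδS hker => (first_order_of_minimal_entropy hγs0 hγsopt hγsent hslack hδ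
      hδS hker).1)
    (fun δ hδ hker => by
      have h1 := (first_order_of_minimal_entropy hγs0 hγsopt hγsent hslack
        (fun p hp => (hδ p hp).ge) (fun p _ hp => hδ p hp) hker).2
      have h2 := (first_order_of_minimal_entropy hγs0 hγsopt hγsent hslack (δ := -δ)
        (fun p hp => by simp [hδ p hp]) (fun p _ hp => by simp [hδ p hp])
        (by rw [← margLin_apply, map_neg, margLin_apply, hker, neg_zero])).2
      simp only [Pi.neg_apply, neg_mul, Finset.sum_neg_distrib] at h2
      linarith)
  obtain ⟨L, U, hU, hLip⟩ :=
    ((hF6.fderiv_right (m := 1) (by norm_num)).contDiffAt (x := -ξs)).exists_lipschitzOnWith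
  obtain ⟨r, hr, hrU⟩ := Metric.mem_nhds_iff.1 hU
  obtain ⟨κ, hκ, hgap⟩ : ∃ κ > 0, ∀ p, adjA ξs p ≠ c p → κ ≤ c p - adjA ξs p := by
    have h (p : X × Y) : ∃ κ > 0, adjA ξs p ≠ c p → κ ≤ c p - adjA ξs p := by
      by_cases hp : adjA ξs p = c p
      · exact ⟨1, one_pos, fun h => absurd hp h⟩
      · exact ⟨c p - adjA ξs p, sub_pos.2 (lt_of_le_of_ne (hfeas p) hp), fun _ => le_rfl⟩
    choose k hk hk' using h
    obtain ⟨p₀, hp₀⟩ := Finite.exists_min k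
    exact ⟨k p₀, hk p₀, fun p hp => (hp₀ p).trans (hk' p hp)⟩
  set C₂ : ℝ := L * C₁ + 2 / κ with hC₂
  have hC₂0 : 0 < C₂ := by positivity
  refine ⟨K * C₂, by positivity,
    T₁ + (C₁ / (r / 2)) ^ 2 + (C₁ / (κ / 4)) ^ 2 + (C₂ / ε) ^ 2, by positivity, fun t ht => ?_⟩
  have hp₁ : 0 ≤ (C₁ / (r / 2)) ^ 2 := sq_nonneg _
  have hp₂ : 0 ≤ (C₁ / (κ / 4)) ^ 2 := sq_nonneg _
  have hp₃ : 0 ≤ (C₂ / ε) ^ 2 := sq_nonneg _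
  have ht1 : 1 ≤ t := by linarith
  have ht0 : 0 < t := by linarith
  have hsqrt : 0 < √t := Real.sqrt_pos.2 ht0
  obtain ⟨ξ, -, -, hξ⟩ := hdual t ht1
  have hdist := hrate t (by linarith) ξ hξ
  have hdist_r := hdist.trans (div_sqrt_le_of_sq_le hC₁ (half_pos hr) (by linarith))
  have hdist_κ := hdist.trans
    (div_sqrt_le_of_sq_le hC₁ (ε := κ / 4) (by positivity) (by linarith))
  rw [eq_gibbs_of_minimizer hF1 hF3 hFs hdiff ht0 hξ (hgam t ht0), mul_div_assoc]
  have hnorm : ‖-ξ - -ξs‖ = ‖ξ - ξs‖ := by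
    rw [← norm_neg]
    congr 1
    abel
  refine hstab _ (t • (ξ - ξs)) _ (gibbs_pos t ξ) (fun p hp => ?_) (by positivity)
    (div_sqrt_le_of_sq_le hC₂0 hε (by linarith)) ?_ (fun p hp => ?_)
  · have h1 := (mul_eq_zero.1 (hslack p)).resolve_left hp
    rw [log_gibbs, adjA_smul, adjA_sub, sub_eq_zero.1 h1]
  · have h1 : ‖margA (gibbs c t ξ) - margA γs‖ ≤ L * ‖-ξ - -ξs‖ := by
      refine (norm_sub_le_norm_dotCLM_sub _ _).trans ?_
      rw [← fderiv_eq_of_dual_minimizer hdiff ht0 hξ,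
        ← fderiv_eq_dotCLM_of_subgradient hdiff (subgradient_of_fenchel_eq hF1 hFs hval)]
      refine hLip.norm_sub_le (hrU ?_) (hrU (Metric.mem_ball_self hr))
      rw [Metric.mem_ball, dist_eq_norm, hnorm]
      linarith
    rw [hnorm] at h1
    calc ‖margA (gibbs c t ξ) - margA γs‖ ≤ L * (C₁ / √t) := h1.trans (by gcongr)
      _ = L * C₁ / √t := by ring
      _ ≤ C₂ / √t := by
          gcongr
          exact le_add_of_nonneg_right (by positivity)
  · have h1 := hgap p hp
    have h2 := (le_abs_self _).trans (abs_adjA_le (ξ - ξs) p)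
    rw [adjA_sub] at h2
    have h3 : t * (adjA ξ p - c p) ≤ -(t * (κ / 2)) := by
      rw [← mul_neg]
      exact mul_le_mul_of_nonneg_left (by linarith) ht0.le
    have h4 : t * (κ / 2) ≤ Real.exp (t * (κ / 2)) := by
      linarith [Real.add_one_le_exp (t * (κ / 2))]
    have h5 : √t ≤ t := Real.sqrt_le_self_iff.2 (Or.inr ht1)
    calc gibbs c t ξ p ≤ Real.exp (-(t * (κ / 2))) := Real.exp_le_exp.2 h3
      _ = (Real.exp (t * (κ / 2)))⁻¹ := Real.exp_neg _
      _ ≤ (t * (κ / 2))⁻¹ := by gcongr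
      _ = 2 / κ / t := by field_simp
      _ ≤ 2 / κ / √t := by gcongr
      _ ≤ C₂ / √t := by
          gcongr
          exact le_add_of_nonneg_left (by positivity)
end
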